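/- (Defect formula, nodal case.) Let n ≥ 2, d ≥ 3, and let F ∈ ℂ[x₀,…,x_n] be homogeneous of degree d such that the hypersurface {F=0} ⊂ ℙⁿ has exactly p singular points a₁,…,a_p, all of them nodes (A₁ singularities). Then for every integer k with 0 ≤ k ≤ nd − 2n − 1, one has dim M(F)_{T−k} = m_k + dim coker θ_k, where T = (n+1)(d−2), m_k is the coefficient of t^k in ((1 − t^{d−1})/(1 − t))^{n+1} (the dimension of M(F_s)_k for a smooth degree-d form F_s), and θ_k : S_k → ℂ^p is the evaluation map H ↦ (H(a₁),…,H(a_p)) at representatives of the singular points. -/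

import Mathlib

open MvPolynomial

/-- The Jacobian ideal of `F`. -/
noncomputable def jacobianIdeal {N : ℕ} (F : MvPolynomial (Fin N) ℂ) :
    Ideal (MvPolynomial (Fin N) ℂ) :=
  Ideal.span (Set.range fun i => pderiv i F)

/-- The degree-`k` graded piece `M(F)_k = S_k/J_{F,k}` of the Milnor algebra, realized as
the image of `S_k` in `S/J_F`. -/
noncomputable def milnorPiece {N : ℕ} (F : MvPolynomial (Fin N) ℂ) (k : ℕ) :
    Submodule ℂ
      (MvPolynomial (Fin N) ℂ ⧸ Submodule.restrictScalars ℂ (jacobianIdeal F)) :=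
  Submodule.map (Submodule.mkQ _) (homogeneousSubmodule (Fin N) ℂ k)

/-- The coefficient of `t^k` in `(1 + t + ⋯ + t^{d-2})^N`, i.e. the dimension of the
degree-`k` piece of the Milnor algebra of a smooth degree-`d` form in `N` variables. -/
noncomputable def hilbCoeff (N d k : ℕ) : ℕ :=
  (((∑ i ∈ Finset.range (d - 1), (Polynomial.X : Polynomial ℕ) ^ i)) ^ N).coeff k

namespace NodalDefect

/-- `x` is a nonzerodivisor modulo `I`. -/
def Nz {R : Type*} [CommRing R] (I : Ideal R) (x : R) : Prop := ∀ u, x * u ∈ I → u ∈ I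

/-- `I + (x)` -/
def adj {R : Type*} [CommRing R] (I : Ideal R) (x : R) : Ideal R := I ⊔ Ideal.span {x}

theorem mem_adj {R : Type*} [CommRing R] {I : Ideal R} {x u : R} :
    u ∈ adj I x ↔ ∃ s, u - x * s ∈ I := by
  unfold adj
  rw [sup_comm, Ideal.mem_span_singleton_sup]
  constructor
  · rintro ⟨a, b, hb, rfl⟩
    exact ⟨a, by convert hb using 1; ring⟩
  · rintro ⟨s, hs⟩
    exact ⟨s, _, hs, by ring⟩

theorem le_adj {R : Type*} [CommRing R] (I : Ideal R) (x : R) : I ≤ adj I x := le_sup_left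

theorem self_mem_adj {R : Type*} [CommRing R] (I : Ideal R) (x : R) : x ∈ adj I x :=
  mem_adj.2 ⟨1, by simp⟩

theorem adj_comm {R : Type*} [CommRing R] (I : Ideal R) (x y : R) :
    adj (adj I x) y = adj (adj I y) x := by
  unfold adj; rw [sup_assoc, sup_assoc, sup_comm (Ideal.span {x})]

theorem mul_mem_adj_mul_iff {R : Type*} [CommRing R] {I : Ideal R} {x y u : R} (hy : Nz I y) :
    y * u ∈ adj I (x * y) ↔ u ∈ adj I x := by
  simp only [mem_adj]
  constructor
  · rintro ⟨s, hs⟩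
    exact ⟨s, hy _ (by convert hs using 1; ring)⟩
  · rintro ⟨s, hs⟩
    exact ⟨s, by convert I.mul_mem_left y hs using 1; ring⟩

section poly
variable {N : ℕ}

/-- The ideal is homogeneous. -/
def Hom (I : Ideal (MvPolynomial (Fin N) ℂ)) : Prop :=
  ∀ u ∈ I, ∀ k, homogeneousComponent k u ∈ I

theorem homComp_mul {x : MvPolynomial (Fin N) ℂ} {a : ℕ} (hx : x.IsHomogeneous a)
    (s : MvPolynomial (Fin N) ℂ) (k : ℕ) :
    homogeneousComponent (k + a) (x * s) = x * homogeneousComponent k s := by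
  conv_lhs => rw [← sum_homogeneousComponent s, Finset.mul_sum, map_sum]
  have : ∀ i, homogeneousComponent (k + a) (x * homogeneousComponent i s) =
      if i = k then x * homogeneousComponent i s else 0 := by
    intro i
    have h := homogeneousComponent_of_mem (n := a + i) (m := k + a)
      (p := x * homogeneousComponent i s)
      (hx.mul (homogeneousComponent_isHomogeneous i s))
    rw [h]
    by_cases hik : i = k
    · subst hik; simp [add_comm]
    · rw [if_neg (by omega), if_neg hik]
  simp only [this]
  rw [Finset.sum_ite_eq']
  split_ifs with h
  · rfl
  · rw [homogeneousComponent_eq_zero, mul_zero]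
    simp at h; omega

theorem homComp_mul_lt {x : MvPolynomial (Fin N) ℂ} {a : ℕ} (hx : x.IsHomogeneous a)
    (s : MvPolynomial (Fin N) ℂ) (k : ℕ) (hk : k < a) :
    homogeneousComponent k (x * s) = 0 := by
  conv_lhs => rw [← sum_homogeneousComponent s, Finset.mul_sum, map_sum]
  apply Finset.sum_eq_zero
  intro i _
  rw [homogeneousComponent_of_mem (n := a + i) (m := k)
      (hx.mul (homogeneousComponent_isHomogeneous i s)), if_neg (by omega)]

theorem homComp_self {u : MvPolynomial (Fin N) ℂ} {k : ℕ} (hu : u.IsHomogeneous k) :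
    homogeneousComponent k u = u := by
  rw [homogeneousComponent_of_mem (m := k) hu, if_pos rfl]

theorem mem_of_comp {I : Ideal (MvPolynomial (Fin N) ℂ)} {u : MvPolynomial (Fin N) ℂ}
    (h : ∀ k, homogeneousComponent k u ∈ I) : u ∈ I := by
  rw [← sum_homogeneousComponent u]
  exact I.sum_mem fun i _ => h i

theorem Hom.adj {I : Ideal (MvPolynomial (Fin N) ℂ)} (hI : Hom I) {x : MvPolynomial (Fin N) ℂ}
    {a : ℕ} (hx : x.IsHomogeneous a) : Hom (adj I x) := by
  intro u hu k
  rw [mem_adj] at hu ⊢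
  obtain ⟨s, hs⟩ := hu
  by_cases hk : k < a
  · refine ⟨0, ?_⟩
    have := hI _ hs k
    rw [map_sub, homComp_mul_lt hx _ _ hk] at this
    simpa using this
  · obtain ⟨j, rfl⟩ := Nat.exists_eq_add_of_le' (not_lt.1 hk)
    refine ⟨homogeneousComponent j s, ?_⟩
    have := hI _ hs (j + a)
    rwa [map_sub, homComp_mul hx] at this

/-- decomposition of a homogeneous element of `I + (x)` -/
theorem mem_adj_hom {I : Ideal (MvPolynomial (Fin N) ℂ)} (hI : Hom I)
    {x : MvPolynomial (Fin N) ℂ}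
    {a : ℕ} (hx : x.IsHomogeneous a) {u : MvPolynomial (Fin N) ℂ} {k : ℕ}
    (hu : u.IsHomogeneous (k + a)) (h : u ∈ NodalDefect.adj I x) :
    ∃ s : MvPolynomial (Fin N) ℂ, s.IsHomogeneous k ∧ u - x * s ∈ I := by
  obtain ⟨s, hs⟩ := mem_adj.1 h
  refine ⟨homogeneousComponent k s, homogeneousComponent_isHomogeneous _ _, ?_⟩
  have := hI _ hs (k + a)
  rwa [map_sub, homComp_mul hx, homComp_self hu] at this

theorem mem_adj_hom_lt {I : Ideal (MvPolynomial (Fin N) ℂ)} (hI : Hom I)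
    {x : MvPolynomial (Fin N) ℂ}
    {a : ℕ} (hx : x.IsHomogeneous a) {u : MvPolynomial (Fin N) ℂ} {k : ℕ} (hk : k < a)
    (hu : u.IsHomogeneous k) (h : u ∈ NodalDefect.adj I x) : u ∈ I := by
  obtain ⟨s, hs⟩ := mem_adj.1 h
  have := hI _ hs k
  rwa [map_sub, homComp_mul_lt hx _ _ hk, homComp_self hu, sub_zero] at this

theorem perm {I : Ideal (MvPolynomial (Fin N) ℂ)} (hI : Hom I)
    {x z : MvPolynomial (Fin N) ℂ} {a b : ℕ} (hx : x.IsHomogeneous a) (ha : 1 ≤ a)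
    (hz : z.IsHomogeneous b) (hnx : Nz I x) (hnz : Nz (adj I x) z) :
    Nz I z ∧ Nz (adj I z) x := by
  have key : ∀ k, ∀ u : MvPolynomial (Fin N) ℂ, u.IsHomogeneous k → z * u ∈ I → u ∈ I := by
    intro k
    induction k using Nat.strong_induction_on with
    | _ k ih =>
      intro u hu hzu
      have h1 : u ∈ adj I x := hnz u (le_adj _ _ hzu)
      by_cases hk : k < a
      · exact mem_adj_hom_lt hI hx hk hu h1
      · obtain ⟨j, rfl⟩ := Nat.exists_eq_add_of_le' (not_lt.1 hk)
        obtain ⟨s, hs, hus⟩ := mem_adj_hom hI hx hu h1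
        have h2 : z * s ∈ I := by
          apply hnx
          have := I.sub_mem hzu (I.mul_mem_left z hus)
          convert this using 1; ring
        have h3 := ih j (by omega) s hs h2
        have := I.add_mem hus (I.mul_mem_left x h3)
        convert this using 1; ring
  have hz' : Nz I z := by
    intro u hu
    apply mem_of_comp
    intro k
    apply key k _ (homogeneousComponent_isHomogeneous _ _)
    have := hI _ hu (k + b)
    rwa [homComp_mul hz] at this
  refine ⟨hz', ?_⟩
  intro u hu
  obtain ⟨v, hv⟩ := mem_adj.1 hu
  -- z v ∈ I + x
  have h1 : v ∈ adj I x := by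
    apply hnz
    rw [mem_adj]
    refine ⟨u, ?_⟩
    convert I.neg_mem hv using 1; ring
  obtain ⟨w, hw⟩ := mem_adj.1 h1
  rw [mem_adj]
  refine ⟨w, hnx _ ?_⟩
  convert I.add_mem hv (I.mul_mem_left z hw) using 1; ring

/-- trivial socle -/
def SocZero (I : Ideal (MvPolynomial (Fin N) ℂ)) : Prop :=
  ∀ u, (∀ i, X i * u ∈ I) → u ∈ I

/-- one-dimensional socle -/
def SocOne (I : Ideal (MvPolynomial (Fin N) ℂ)) : Prop :=
  ∃ w, w ∉ I ∧ (∀ i, X i * w ∈ I) ∧ ∀ v, (∀ i, X i * v ∈ I) → ∃ c : ℂ, v - C c * w ∈ I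

theorem mul_mem_of_soc {I : Ideal (MvPolynomial (Fin N) ℂ)} {v : MvPolynomial (Fin N) ℂ}
    (hv : ∀ i, X i * v ∈ I) {x : MvPolynomial (Fin N) ℂ} (hx : constantCoeff x = 0) :
    x * v ∈ I := by
  have h : x ∈ Ideal.span (X '' (Set.univ : Set (Fin N)) : Set (MvPolynomial (Fin N) ℂ)) := by
    rw [mem_ideal_span_X_image]
    intro m hm
    by_contra hcon
    push Not at hcon
    have : m = 0 := by ext i; exact hcon i (Set.mem_univ _)
    subst this
    rw [mem_support_iff] at hm
    exact hm hx
  clear hx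
  induction h using Submodule.span_induction with
  | mem y hy => obtain ⟨i, _, rfl⟩ := hy; exact hv i
  | zero => simp
  | add y z _ _ hy hz => rw [add_mul]; exact I.add_mem hy hz
  | smul r y _ hy => rw [smul_eq_mul, mul_assoc]; exact I.mul_mem_left _ hy

theorem constCoeff_hom {x : MvPolynomial (Fin N) ℂ} {a : ℕ} (hx : x.IsHomogeneous a)
    (ha : 1 ≤ a) : constantCoeff x = 0 := by
  rw [constantCoeff_eq]
  apply hx.coeff_eq_zero
  simp; omega

/-- every socle element of `I + (xy)` is a multiple of `y`. -/
theorem soc_mul {I : Ideal (MvPolynomial (Fin N) ℂ)} {x y : MvPolynomial (Fin N) ℂ}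
    (hx : Nz I x) (hy : Nz I y) (hx0 : constantCoeff x = 0) {v : MvPolynomial (Fin N) ℂ}
    (hv : ∀ i, X i * v ∈ adj I (x * y)) :
    ∃ u, v - y * u ∈ I ∧ ∀ i, X i * u ∈ adj I x := by
  have h1 : x * v ∈ adj I (y * x) := by rw [mul_comm y x]; exact mul_mem_of_soc hv hx0
  rw [mul_mem_adj_mul_iff hx, mem_adj] at h1
  obtain ⟨u, hu⟩ := h1
  refine ⟨u, hu, fun i => ?_⟩
  rw [← mul_mem_adj_mul_iff hy]
  have := (adj I (x * y)).sub_mem (hv i) ((adj I (x * y)).mul_mem_left (X i) (le_adj _ _ hu))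
  convert this using 1; ring

theorem socZero_mul {I : Ideal (MvPolynomial (Fin N) ℂ)} {x y : MvPolynomial (Fin N) ℂ}
    (hx : Nz I x) (hy : Nz I y) (hx0 : constantCoeff x = 0) :
    SocZero (adj I x) ↔ SocZero (adj I (x * y)) := by
  constructor
  · intro h v hv
    obtain ⟨u, hu, hu'⟩ := soc_mul hx hy hx0 hv
    have := (mul_mem_adj_mul_iff hy).2 (h u hu')
    have := (adj I (x * y)).add_mem (le_adj _ _ hu) this
    convert this using 1; ring
  · intro h v hv
    rw [← mul_mem_adj_mul_iff hy]
    apply h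
    intro i
    rw [mul_left_comm, mul_mem_adj_mul_iff hy]
    exact hv i

theorem socOne_mul {I : Ideal (MvPolynomial (Fin N) ℂ)} {x y : MvPolynomial (Fin N) ℂ}
    (hx : Nz I x) (hy : Nz I y) (hx0 : constantCoeff x = 0) :
    SocOne (adj I x) ↔ SocOne (adj I (x * y)) := by
  constructor
  · rintro ⟨w, hw, hw1, hw2⟩
    refine ⟨y * w, by rwa [mul_mem_adj_mul_iff hy], fun i => ?_, fun v hv => ?_⟩
    · rw [mul_left_comm, mul_mem_adj_mul_iff hy]; exact hw1 i
    · obtain ⟨u, hu, hu'⟩ := soc_mul hx hy hx0 hv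
      obtain ⟨c, hc⟩ := hw2 u hu'
      refine ⟨c, ?_⟩
      have := (adj I (x * y)).add_mem (le_adj _ _ hu) ((mul_mem_adj_mul_iff hy).2 hc)
      convert this using 1; ring
  · rintro ⟨w, hw, hw1, hw2⟩
    obtain ⟨u, hu, hu'⟩ := soc_mul hx hy hx0 hw1
    refine ⟨u, fun h => hw ?_, hu', fun v hv => ?_⟩
    · have := (adj I (x * y)).add_mem (le_adj _ _ hu) ((mul_mem_adj_mul_iff hy).2 h)
      convert this using 1; ring
    · obtain ⟨c, hc⟩ := hw2 (y * v) (fun i => by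
        rw [mul_left_comm, mul_mem_adj_mul_iff hy]; exact hv i)
      refine ⟨c, ?_⟩
      rw [← mul_mem_adj_mul_iff hy]
      have := (adj I (x * y)).add_mem hc
        ((adj I (x * y)).mul_mem_left (C c) (le_adj _ _ hu))
      convert this using 1; ring

theorem socZero_swap {I : Ideal (MvPolynomial (Fin N) ℂ)} {x y : MvPolynomial (Fin N) ℂ}
    (hx : Nz I x) (hy : Nz I y) (hx0 : constantCoeff x = 0) (hy0 : constantCoeff y = 0)
    (h : SocZero (adj I x)) : SocZero (adj I y) := by
  rw [socZero_mul hy hx hy0, mul_comm, ← socZero_mul hx hy hx0]; exact h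

theorem socOne_swap {I : Ideal (MvPolynomial (Fin N) ℂ)} {x y : MvPolynomial (Fin N) ℂ}
    (hx : Nz I x) (hy : Nz I y) (hx0 : constantCoeff x = 0) (hy0 : constantCoeff y = 0)
    (h : SocOne (adj I x)) : SocOne (adj I y) := by
  rw [socOne_mul hy hx hy0, mul_comm, ← socOne_mul hx hy hx0]; exact h

/-- Prime avoidance over the infinite field `ℂ`. -/
theorem avoid (I I' : Ideal (MvPolynomial (Fin N) ℂ)) (W : Submodule ℂ (MvPolynomial (Fin N) ℂ))
    (h : ∀ u, (∀ w ∈ W, w * u ∈ I) → u ∈ I) (h' : ∀ u, (∀ w ∈ W, w * u ∈ I') → u ∈ I') :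
    ∃ w ∈ W, Nz I w ∧ Nz I' w := by
  classical
  let M := (MvPolynomial (Fin N) ℂ ⧸ I) × (MvPolynomial (Fin N) ℂ ⧸ I')
  have hfin : (associatedPrimes (MvPolynomial (Fin N) ℂ) M).Finite := associatedPrimes.finite _ _
  let s : Finset (Subspace ℂ W) := hfin.toFinset.image
    (fun P => (P.restrictScalars ℂ).comap W.subtype)
  have hs : ⊤ ∉ s := by
    intro hs
    obtain ⟨P, hP, hP'⟩ := Finset.mem_image.1 hs
    rw [Set.Finite.mem_toFinset, AssociatedPrimes.mem_iff, isAssociatedPrime_iff] at hP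
    obtain ⟨hprime, ⟨x1, x2⟩, hx⟩ := hP
    obtain ⟨u, rfl⟩ := Ideal.Quotient.mk_surjective x1
    obtain ⟨v, rfl⟩ := Ideal.Quotient.mk_surjective x2
    have hW : ∀ w ∈ W, w ∈ P := by
      intro w hw
      have : (⟨w, hw⟩ : W) ∈ (P.restrictScalars ℂ).comap W.subtype := by rw [hP']; trivial
      exact this
    have hP2 : ∀ w, w ∈ P ↔ (w * u ∈ I ∧ w * v ∈ I') := by
      intro w
      rw [hx, Submodule.mem_colon_singleton]
      rw [Submodule.mem_bot, ← Ideal.Quotient.eq_zero_iff_mem, ← Ideal.Quotient.eq_zero_iff_mem]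
      exact Prod.mk_eq_zero
    apply hprime.ne_top
    rw [Ideal.eq_top_iff_one, hP2]
    simp only [one_mul]
    exact ⟨h u fun w hw => ((hP2 w).1 (hW w hw)).1, h' v fun w hw => ((hP2 w).1 (hW w hw)).2⟩
  have h2 := Subspace.biUnion_ne_univ_of_top_notMem hs
  obtain ⟨⟨w, hw⟩, hw'⟩ := (Set.ne_univ_iff_exists_notMem _).1 h2
  have hreg : IsSMulRegular M w := by
    by_contra hcon
    have : w ∈ ⋃ p ∈ associatedPrimes (MvPolynomial (Fin N) ℂ) M,
        (p : Set (MvPolynomial (Fin N) ℂ)) := by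
      rw [biUnion_associatedPrimes_eq_compl_regular]; exact hcon
    apply hw'
    simp only [Set.mem_iUnion] at this ⊢
    obtain ⟨p, hp, hwp⟩ := this
    exact ⟨_, Finset.mem_image.2 ⟨p, hfin.mem_toFinset.2 hp, rfl⟩, hwp⟩
  rw [isSMulRegular_iff_right_eq_zero_of_smul] at hreg
  refine ⟨w, hw, fun u hu => ?_, fun u hu => ?_⟩
  · have := hreg (Ideal.Quotient.mk I u, 0) (by
      rw [Prod.smul_mk, smul_zero, Prod.mk_eq_zero]
      exact ⟨Ideal.Quotient.eq_zero_iff_mem.2 hu, rfl⟩)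
    exact Ideal.Quotient.eq_zero_iff_mem.1 (Prod.mk_eq_zero.1 this).1
  · have := hreg (0, Ideal.Quotient.mk I' u) (by
      rw [Prod.smul_mk, smul_zero, Prod.mk_eq_zero]
      exact ⟨rfl, Ideal.Quotient.eq_zero_iff_mem.2 hu⟩)
    exact Ideal.Quotient.eq_zero_iff_mem.1 (Prod.mk_eq_zero.1 this).2

/-- `S/I` has depth `t` and one-dimensional socle after cutting down by linear forms. -/
def Dp : ℕ → Ideal (MvPolynomial (Fin N) ℂ) → Prop
  | 0, I => SocOne I
  | t + 1, I => SocZero I ∧ ∃ z : MvPolynomial (Fin N) ℂ, z.IsHomogeneous 1 ∧ Nz I z ∧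
      Dp t (adj I z)

theorem Dp_swap (t : ℕ) : ∀ (I : Ideal (MvPolynomial (Fin N) ℂ)), Hom I →
    ∀ (x y : MvPolynomial (Fin N) ℂ) (a b : ℕ), x.IsHomogeneous a → 1 ≤ a → y.IsHomogeneous b →
    1 ≤ b → Nz I x → Nz I y → Dp t (adj I x) → Dp t (adj I y) := by
  induction t with
  | zero =>
    intro I hI x y a b hx ha hy hb hnx hny h
    exact socOne_swap hnx hny (constCoeff_hom hx ha) (constCoeff_hom hy hb) h
  | succ t ih =>
    intro I hI x y a b hx ha hy hb hnx hny h
    obtain ⟨h0, z, hz, hnz, hd⟩ := h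
    have h0y := socZero_swap hnx hny (constCoeff_hom hx ha) (constCoeff_hom hy hb) h0
    refine ⟨h0y, ?_⟩
    obtain ⟨w, hw, hw1, hw2⟩ := avoid (adj I x) (adj I y) (homogeneousSubmodule (Fin N) ℂ 1)
      (fun u hu => h0 u fun i => hu _ (isHomogeneous_X _ i))
      (fun u hu => h0y u fun i => hu _ (isHomogeneous_X _ i))
    rw [mem_homogeneousSubmodule] at hw
    refine ⟨w, hw, hw2, ?_⟩
    have h1 := ih (adj I x) (hI.adj hx) z w 1 1 hz le_rfl hw le_rfl hnz hw1 hd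
    have p1 := perm hI hx ha hw hnx hw1
    have p2 := perm hI hy hb hw hny hw2
    rw [adj_comm] at h1 ⊢
    exact ih (adj I w) (hI.adj hw) x y a b hx ha hy hb p1.2 p2.2 h1

theorem Dp_cut {t : ℕ} {I : Ideal (MvPolynomial (Fin N) ℂ)} (hI : Hom I) (h : Dp (t + 1) I)
    {y : MvPolynomial (Fin N) ℂ} {b : ℕ} (hy : y.IsHomogeneous b) (hb : 1 ≤ b) (hny : Nz I y) :
    Dp t (adj I y) := by
  obtain ⟨h0, z, hz, hnz, hd⟩ := h
  exact Dp_swap t I hI z y 1 b hz le_rfl hy hb hnz hny hd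

theorem Dp_ne_top {t : ℕ} : ∀ {I : Ideal (MvPolynomial (Fin N) ℂ)}, Dp t I → I ≠ ⊤ := by
  induction t with
  | zero => rintro I ⟨w, hw, _⟩ rfl; exact hw trivial
  | succ t ih =>
    rintro I ⟨_, z, _, _, hd⟩ rfl
    exact ih hd (top_le_iff.1 (le_adj _ _))

/-- ideal of the first `i` variables -/
noncomputable def varI (N i : ℕ) : Ideal (MvPolynomial (Fin N) ℂ) :=
  Ideal.span (X '' {j : Fin N | (j : ℕ) < i})

theorem varI_zero : varI N 0 = ⊥ := by simp [varI]

theorem varI_succ (i : ℕ) (hi : i < N) : varI N (i + 1) = adj (varI N i) (X ⟨i, hi⟩) := by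
  unfold varI adj
  rw [← Ideal.span_union, ← Set.image_singleton, ← Set.image_union]
  congr 2
  ext j
  simp [Fin.ext_iff]; omega

theorem varI_nz (i : ℕ) (hi : i < N) : Nz (varI N i) (X ⟨i, hi⟩) := by
  intro u hu
  unfold varI at *
  rw [mem_ideal_span_X_image] at *
  intro m hm
  obtain ⟨j, hj, hj'⟩ := hu (Finsupp.single ⟨i, hi⟩ 1 + m) (by
    rw [support_X_mul]; simpa using hm)
  refine ⟨j, hj, ?_⟩
  have : (⟨i, hi⟩ : Fin N) ≠ j := by rintro rfl; simp at hj
  simpa [Finsupp.single_apply, this] using hj'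

theorem varI_hom (i : ℕ) (hi : i ≤ N) : Hom (varI N i) := by
  induction i with
  | zero => rw [varI_zero]; intro u hu k; simp at hu; simp [hu]
  | succ i ih => rw [varI_succ i hi]; exact (ih (by omega)).adj (isHomogeneous_X _ _)

theorem mem_varI_top (u : MvPolynomial (Fin N) ℂ) : u ∈ varI N N ↔ constantCoeff u = 0 := by
  unfold varI
  rw [mem_ideal_span_X_image]
  constructor
  · intro h
    by_contra hc
    obtain ⟨j, _, hj⟩ := h 0 (by rwa [mem_support_iff])
    simp at hj
  · intro h m hm
    by_contra hcon
    push Not at hcon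
    have : m = 0 := by ext i; exact hcon i i.2
    subst this
    rw [mem_support_iff] at hm
    exact hm h

theorem Dp_varI (t : ℕ) (ht : t ≤ N) : Dp t (varI N (N - t)) := by
  induction t with
  | zero =>
    refine ⟨1, ?_, ?_, ?_⟩
    · simp [mem_varI_top]
    · intro i; simp [mem_varI_top]
    · intro v _; exact ⟨constantCoeff v, by simp [mem_varI_top]⟩
  | succ t ih =>
    have hi : N - (t + 1) < N := by omega
    have hn := varI_nz (N - (t + 1)) hi
    refine ⟨fun u hu => hn u (hu _), X ⟨_, hi⟩, isHomogeneous_X _ _, hn, ?_⟩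
    rw [← varI_succ]
    have := ih (by omega)
    convert this using 2; omega

theorem Dp_bot : Dp N (⊥ : Ideal (MvPolynomial (Fin N) ℂ)) := by
  have := Dp_varI N (le_refl N)
  rwa [Nat.sub_self, varI_zero] at this

end poly

section hilb
variable {N : ℕ}

theorem rank_eq {V W W' : Type*} [AddCommGroup V] [Module ℂ V] [AddCommGroup W] [Module ℂ W]
    [AddCommGroup W'] [Module ℂ W'] (φ : V →ₗ[ℂ] W) (ψ : V →ₗ[ℂ] W') (U : Submodule ℂ V)
    (h : ∀ u ∈ U, φ u = 0 ↔ ψ u = 0) :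
    Module.finrank ℂ (U.map φ) = Module.finrank ℂ (U.map ψ) := by
  have hk : LinearMap.ker (φ.domRestrict U) = LinearMap.ker (ψ.domRestrict U) := by
    ext u
    simpa using h u u.2
  rw [← LinearMap.range_domRestrict, ← LinearMap.range_domRestrict]
  rw [← (LinearMap.quotKerEquivRange (φ.domRestrict U)).finrank_eq,
    ← (LinearMap.quotKerEquivRange (ψ.domRestrict U)).finrank_eq, hk]

theorem rank_null {V W : Type*} [AddCommGroup V] [Module ℂ V] [AddCommGroup W] [Module ℂ W]
    (φ : V →ₗ[ℂ] W) (U : Submodule ℂ V) [FiniteDimensional ℂ U] :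
    Module.finrank ℂ (U.map φ) + Module.finrank ℂ (U ⊓ LinearMap.ker φ : Submodule ℂ V) =
      Module.finrank ℂ U := by
  rw [← LinearMap.range_domRestrict, ← LinearMap.finrank_range_add_finrank_ker (φ.domRestrict U)]
  congr 1
  rw [← Submodule.finrank_map_subtype_eq, LinearMap.ker_domRestrict, Submodule.map_comap_subtype]

instance homFin (k : ℕ) : FiniteDimensional ℂ (homogeneousSubmodule (Fin N) ℂ k) :=
  Module.Finite.iff_fg.2 (homogeneousSubmodule_fg _ _ k)

/-- Hilbert function of `S/I` -/
noncomputable def hf (I : Ideal (MvPolynomial (Fin N) ℂ)) (k : ℕ) : ℕ :=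
  Module.finrank ℂ ((homogeneousSubmodule (Fin N) ℂ k).map
    (Submodule.mkQ (Submodule.restrictScalars ℂ I)))

/-- rank of multiplication by `h` from `S_k` to `S/I` -/
noncomputable def hfm (I : Ideal (MvPolynomial (Fin N) ℂ)) (h : MvPolynomial (Fin N) ℂ)
    (k : ℕ) : ℕ :=
  Module.finrank ℂ ((homogeneousSubmodule (Fin N) ℂ k).map
    ((Submodule.mkQ (Submodule.restrictScalars ℂ I)).comp (LinearMap.mulLeft ℂ h)))

theorem mkQ_eq_zero {I : Ideal (MvPolynomial (Fin N) ℂ)} {u : MvPolynomial (Fin N) ℂ} :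
    Submodule.mkQ (Submodule.restrictScalars ℂ I) u = 0 ↔ u ∈ I := by
  rw [Submodule.mkQ_apply, Submodule.Quotient.mk_eq_zero, Submodule.restrictScalars_mem]

theorem hfm_nz {I : Ideal (MvPolynomial (Fin N) ℂ)} {h : MvPolynomial (Fin N) ℂ} (hh : Nz I h)
    (k : ℕ) : hfm I h k = hf I k := by
  apply rank_eq
  intro u _
  rw [LinearMap.comp_apply, mkQ_eq_zero, mkQ_eq_zero, LinearMap.mulLeft_apply]
  exact ⟨hh u, fun h => I.mul_mem_left _ h⟩

theorem hf_add (I : Ideal (MvPolynomial (Fin N) ℂ)) (k : ℕ) :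
    hf I k + Module.finrank ℂ (homogeneousSubmodule (Fin N) ℂ k ⊓ Submodule.restrictScalars ℂ I :
      Submodule ℂ (MvPolynomial (Fin N) ℂ)) =
      Module.finrank ℂ (homogeneousSubmodule (Fin N) ℂ k) := by
  have := rank_null (Submodule.mkQ (Submodule.restrictScalars ℂ I))
    (homogeneousSubmodule (Fin N) ℂ k)
  rwa [Submodule.ker_mkQ] at this

theorem hf_cut {I : Ideal (MvPolynomial (Fin N) ℂ)} (hI : Hom I) {h : MvPolynomial (Fin N) ℂ}
    {e : ℕ} (hh : h.IsHomogeneous e) (k : ℕ) :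
    hf I (k + e) = hf (adj I h) (k + e) + hfm I h k := by
  have h1 := hf_add I (k + e)
  have h2 := hf_add (adj I h) (k + e)
  have : FiniteDimensional ℂ (homogeneousSubmodule (Fin N) ℂ (k + e) ⊓
      Submodule.restrictScalars ℂ (adj I h) : Submodule ℂ (MvPolynomial (Fin N) ℂ)) :=
    Submodule.finiteDimensional_inf_left _ _
  have h3 := rank_null (Submodule.mkQ (Submodule.restrictScalars ℂ I))
    (homogeneousSubmodule (Fin N) ℂ (k + e) ⊓ Submodule.restrictScalars ℂ (adj I h))
  have h4 : Submodule.map (Submodule.mkQ (Submodule.restrictScalars ℂ I))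
    (homogeneousSubmodule (Fin N) ℂ (k + e) ⊓ Submodule.restrictScalars ℂ (adj I h)) =
    (homogeneousSubmodule (Fin N) ℂ k).map
    ((Submodule.mkQ (Submodule.restrictScalars ℂ I)).comp (LinearMap.mulLeft ℂ h)) := by
    ext v
    simp only [Submodule.mem_map, Submodule.mem_inf, mem_homogeneousSubmodule,
      Submodule.restrictScalars_mem, LinearMap.comp_apply, LinearMap.mulLeft_apply]
    constructor
    · rintro ⟨u, ⟨hu1, hu2⟩, rfl⟩
      obtain ⟨s, hs, hs'⟩ := mem_adj_hom hI hh hu1 hu2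
      refine ⟨s, hs, ?_⟩
      rw [eq_comm, ← sub_eq_zero, ← map_sub, mkQ_eq_zero]
      exact hs'
    · rintro ⟨s, hs, rfl⟩
      exact ⟨h * s, ⟨by rw [add_comm]; exact hh.mul hs, Ideal.mul_mem_right _ _ (self_mem_adj _ _)⟩,
        rfl⟩
  have h5 : homogeneousSubmodule (Fin N) ℂ (k + e) ⊓ Submodule.restrictScalars ℂ (adj I h) ⊓
      LinearMap.ker (Submodule.mkQ (Submodule.restrictScalars ℂ I)) =
      homogeneousSubmodule (Fin N) ℂ (k + e) ⊓ Submodule.restrictScalars ℂ I := by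
    rw [Submodule.ker_mkQ, inf_assoc]
    congr 1
    exact inf_eq_right.2 (fun u hu => le_adj _ _ hu)
  rw [h4, h5] at h3
  change hfm I h k + _ = _ at h3
  omega

theorem hf_cut_lt {I : Ideal (MvPolynomial (Fin N) ℂ)} (hI : Hom I) {h : MvPolynomial (Fin N) ℂ}
    {e : ℕ} (hh : h.IsHomogeneous e) (k : ℕ) (hk : k < e) :
    hf I k = hf (adj I h) k := by
  apply rank_eq
  intro u hu
  rw [mkQ_eq_zero, mkQ_eq_zero]
  exact ⟨fun h => le_adj _ _ h, fun h => mem_adj_hom_lt hI hh hk hu h⟩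

/-- Hilbert series -/
noncomputable def HS (I : Ideal (MvPolynomial (Fin N) ℂ)) : PowerSeries ℤ :=
  PowerSeries.mk fun k => (hf I k : ℤ)

theorem HS_cut {I : Ideal (MvPolynomial (Fin N) ℂ)} (hI : Hom I) {h : MvPolynomial (Fin N) ℂ}
    {e : ℕ} (hh : h.IsHomogeneous e) (hn : Nz I h) :
    HS (adj I h) = (1 - PowerSeries.X ^ e) * HS I := by
  ext k
  rw [sub_mul, one_mul, map_sub, PowerSeries.coeff_X_pow_mul']
  simp only [HS, PowerSeries.coeff_mk]
  split_ifs with hk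
  · obtain ⟨j, rfl⟩ := Nat.exists_eq_add_of_le' hk
    rw [hf_cut hI hh, hfm_nz hn]
    simp
  · rw [hf_cut_lt hI hh k (by omega)]; simp

theorem HS_varI (i : ℕ) (hi : i ≤ N) :
    HS (varI N i) = (1 - PowerSeries.X) ^ i * HS (⊥ : Ideal (MvPolynomial (Fin N) ℂ)) := by
  induction i with
  | zero => simp [varI_zero]
  | succ i ih =>
    rw [varI_succ i hi, HS_cut (varI_hom i (by omega)) (isHomogeneous_X _ _) (varI_nz i hi),
      ih (by omega)]
    ring

theorem HS_varI_top : HS (varI N N) = 1 := by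
  ext k
  simp only [HS, PowerSeries.coeff_mk, PowerSeries.coeff_one]
  split_ifs with hk
  · subst hk
    have h2 := rank_eq (Submodule.mkQ (Submodule.restrictScalars ℂ (varI N N)))
      (lcoeff ℂ (0 : Fin N →₀ ℕ)) (homogeneousSubmodule (Fin N) ℂ 0) (by
        intro u _
        rw [mkQ_eq_zero, mem_varI_top]; rfl)
    unfold hf
    rw [h2]
    have : Submodule.map (lcoeff ℂ (0 : Fin N →₀ ℕ)) (homogeneousSubmodule (Fin N) ℂ 0) = ⊤ := by
      rw [eq_top_iff]
      intro c _
      exact ⟨C c, isHomogeneous_C _ _, by simp⟩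
    rw [this]; simp
  · have : Submodule.map (Submodule.mkQ (Submodule.restrictScalars ℂ (varI N N)))
        (homogeneousSubmodule (Fin N) ℂ k) = ⊥ := by
      rw [eq_bot_iff]
      rintro _ ⟨u, hu, rfl⟩
      rw [Submodule.mem_bot, mkQ_eq_zero, mem_varI_top]
      exact constCoeff_hom hu (by omega)
    unfold hf
    rw [this]; simp

theorem HS_bot : (1 - PowerSeries.X) ^ N * HS (⊥ : Ideal (MvPolynomial (Fin N) ℂ)) = 1 := by
  rw [← HS_varI N le_rfl, HS_varI_top]

/-- `1 + t + ⋯ + t^{e-1}` -/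
noncomputable def G (e : ℕ) : Polynomial ℕ := ∑ i ∈ Finset.range e, Polynomial.X ^ i

theorem coeff_G (e i : ℕ) : (G e).coeff i = if i < e then 1 else 0 := by
  simp [G, Polynomial.coeff_X_pow]

theorem G_natDegree (e : ℕ) (he : 1 ≤ e) : (G e).natDegree = e - 1 := by
  apply le_antisymm
  · rw [Polynomial.natDegree_le_iff_coeff_eq_zero]
    intro i hi
    rw [coeff_G, if_neg (by omega)]
  · apply Polynomial.le_natDegree_of_ne_zero
    rw [coeff_G, if_pos (by omega)]; simp

theorem G_reverse (e : ℕ) (he : 1 ≤ e) : (G e).reverse = G e := by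
  ext i
  rw [Polynomial.coeff_reverse, G_natDegree e he]
  by_cases hi : i ≤ e - 1
  · rw [Polynomial.revAt_le hi, coeff_G, coeff_G, if_pos (by omega), if_pos (by omega)]
  · rw [Polynomial.revAt_eq_self_of_lt (by omega)]

theorem G_pow_reverse (e m : ℕ) (he : 1 ≤ e) : (G e ^ m).reverse = G e ^ m := by
  induction m with
  | zero => rw [pow_zero, ← Polynomial.C_1, Polynomial.reverse_C]
  | succ m ih => rw [pow_succ, Polynomial.reverse_mul_of_domain, ih, G_reverse e he]

theorem G_pow_natDegree (e m : ℕ) (he : 1 ≤ e) : (G e ^ m).natDegree = m * (e - 1) := by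
  rw [Polynomial.natDegree_pow, G_natDegree e he]

theorem G_pow_symm (e m i : ℕ) (he : 1 ≤ e) (hi : i ≤ m * (e - 1)) :
    (G e ^ m).coeff (m * (e - 1) - i) = (G e ^ m).coeff i := by
  conv_rhs => rw [← G_pow_reverse e m he, Polynomial.coeff_reverse, G_pow_natDegree e m he,
    Polynomial.revAt_le hi]

theorem G_pow_gt (e m i : ℕ) (he : 1 ≤ e) (hi : m * (e - 1) < i) : (G e ^ m).coeff i = 0 := by
  apply Polynomial.coeff_eq_zero_of_natDegree_lt
  rwa [G_pow_natDegree e m he]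

theorem G_pow_top (e m : ℕ) (he : 1 ≤ e) : (G e ^ m).coeff (m * (e - 1)) = 1 := by
  have := G_pow_symm e m 0 he (Nat.zero_le _)
  rw [Nat.sub_zero] at this
  rw [this, Polynomial.coeff_zero_eq_eval_zero, Polynomial.eval_pow,
    ← Polynomial.coeff_zero_eq_eval_zero, coeff_G, if_pos (by omega), one_pow]

/-- as an integral power series -/
noncomputable def GS (e : ℕ) : PowerSeries ℤ := ((G e).map (Nat.castRingHom ℤ) : Polynomial ℤ)

theorem GS_coeff (e m i : ℕ) : PowerSeries.coeff i (GS e ^ m) = ((G e ^ m).coeff i : ℤ) := by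
  unfold GS
  rw [← Polynomial.coe_pow, ← Polynomial.map_pow, Polynomial.coeff_coe, Polynomial.coeff_map]
  simp

theorem GS_mul (e : ℕ) : (1 - PowerSeries.X) * GS e = 1 - PowerSeries.X ^ e := by
  have h := mul_neg_geom_sum (PowerSeries.X : PowerSeries ℤ) e
  rw [← h]
  congr 1
  ext i
  have := GS_coeff e 1 i
  rw [pow_one, pow_one] at this
  rw [this, coeff_G]
  simp [PowerSeries.coeff_X_pow]

end hilb

section seq
variable {N : ℕ}

theorem socZero_pow {I : Ideal (MvPolynomial (Fin N) ℂ)} (hI : SocZero I) (r : ℕ) :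
    ∀ u, (∀ v ∈ (varI N N) ^ r, v * u ∈ I) → u ∈ I := by
  induction r with
  | zero => intro u hu; simpa using hu 1 (by simp)
  | succ r ih =>
    intro u hu
    apply hI
    intro i
    apply ih
    intro v hv
    rw [← mul_assoc]
    apply hu
    rw [pow_succ]
    exact Ideal.mul_mem_mul hv (by simp [mem_varI_top])

theorem span_adj (Gs : Submodule ℂ (MvPolynomial (Fin N) ℂ)) (g : MvPolynomial (Fin N) ℂ) :
    Ideal.span ((Gs ⊔ Submodule.span ℂ {g} : Submodule ℂ (MvPolynomial (Fin N) ℂ)) :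
      Set (MvPolynomial (Fin N) ℂ)) = adj (Ideal.span (Gs : Set (MvPolynomial (Fin N) ℂ))) g := by
  apply le_antisymm
  · rw [Ideal.span_le]
    intro x hx
    rw [SetLike.mem_coe, Submodule.mem_sup] at hx
    obtain ⟨y, hy, z, hz, rfl⟩ := hx
    obtain ⟨c, rfl⟩ := Submodule.mem_span_singleton.1 hz
    apply Ideal.add_mem
    · exact le_adj _ _ (Ideal.subset_span hy)
    · rw [MvPolynomial.smul_eq_C_mul]
      exact Ideal.mul_mem_left _ _ (self_mem_adj _ _)
  · unfold adj
    rw [sup_le_iff]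
    constructor
    · exact Ideal.span_mono (fun x hx => Submodule.mem_sup_left hx)
    · rw [Ideal.span_le]
      rintro x hx
      rw [Set.mem_singleton_iff] at hx
      subst hx
      exact Ideal.subset_span (Submodule.mem_sup_right (Submodule.mem_span_singleton_self _))

theorem finrank_sup_one {V : Type*} [AddCommGroup V] [Module ℂ V] (A : Submodule ℂ V)
    [FiniteDimensional ℂ A] {g : V} (hg : g ∉ A) :
    Module.finrank ℂ (A ⊔ Submodule.span ℂ {g} : Submodule ℂ V) = Module.finrank ℂ A + 1 := by
  have h := Submodule.finrank_sup_add_finrank_inf_eq A (Submodule.span ℂ {g})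
  have hg0 : g ≠ 0 := by rintro rfl; exact hg A.zero_mem
  rw [finrank_span_singleton hg0] at h
  have : A ⊓ Submodule.span ℂ {g} = ⊥ := by
    rw [eq_bot_iff]
    rintro x ⟨hx, hx'⟩
    obtain ⟨c, rfl⟩ := Submodule.mem_span_singleton.1 hx'
    by_cases hc : c = 0
    · simp [hc]
    · exact absurd ((A.smul_mem_iff hc).1 hx) hg
  rw [this, finrank_bot] at h
  omega

theorem exists_seq (n e : ℕ) (he : 1 ≤ e) (W : Submodule ℂ (MvPolynomial (Fin (n + 1)) ℂ))
    (hW : ∀ w ∈ W, w.IsHomogeneous e) (l : MvPolynomial (Fin (n + 1)) ℂ)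
    (hl : l.IsHomogeneous 1) (hl0 : l ≠ 0) (r : ℕ)
    (hr : (varI (n + 1) (n + 1)) ^ r ≤
      adj (Ideal.span (W : Set (MvPolynomial (Fin (n + 1)) ℂ))) l) (i : ℕ) (hi : i ≤ n) :
    ∃ Gs : Submodule ℂ (MvPolynomial (Fin (n + 1)) ℂ), Gs ≤ W ∧ Module.Finite ℂ Gs ∧
      Module.finrank ℂ Gs = i ∧
      Hom (Ideal.span (Gs : Set (MvPolynomial (Fin (n + 1)) ℂ))) ∧
      Nz (Ideal.span (Gs : Set (MvPolynomial (Fin (n + 1)) ℂ))) l ∧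
      Dp (n - i) (adj (Ideal.span (Gs : Set (MvPolynomial (Fin (n + 1)) ℂ))) l) ∧
      HS (Ideal.span (Gs : Set (MvPolynomial (Fin (n + 1)) ℂ))) =
        (1 - PowerSeries.X ^ e) ^ i * HS (⊥ : Ideal (MvPolynomial (Fin (n + 1)) ℂ)) := by
  induction i with
  | zero =>
    have hb : Ideal.span (((⊥ : Submodule ℂ (MvPolynomial (Fin (n + 1)) ℂ))) :
        Set (MvPolynomial (Fin (n + 1)) ℂ)) = ⊥ := by simp
    have hh : Hom (⊥ : Ideal (MvPolynomial (Fin (n + 1)) ℂ)) := by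
      rw [← varI_zero]; exact varI_hom 0 (by omega)
    have hnz : Nz (⊥ : Ideal (MvPolynomial (Fin (n + 1)) ℂ)) l := by
      intro u hu
      rw [Ideal.mem_bot] at hu ⊢
      exact (mul_eq_zero.1 hu).resolve_left hl0
    refine ⟨⊥, bot_le, inferInstance, by simp, ?_⟩
    rw [hb]
    refine ⟨hh, hnz, ?_, by simp⟩
    exact Dp_cut hh Dp_bot hl le_rfl hnz
  | succ i ih =>
    obtain ⟨Gs, hG, hfin, hrank, hhom, hnz, hd, hH⟩ := ih (by omega)
    set I := Ideal.span (Gs : Set (MvPolynomial (Fin (n + 1)) ℂ)) with hIdef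
    obtain ⟨t, ht, ht'⟩ : ∃ t, n - i = t + 1 ∧ n - (i + 1) = t := ⟨n - (i + 1), by omega, rfl⟩
    rw [ht] at hd
    rw [ht']
    have hs : ∀ u, (∀ w ∈ W, w * u ∈ adj I l) → u ∈ adj I l := by
      intro u hu
      apply socZero_pow hd.1 r
      intro v hv
      obtain ⟨s, hs⟩ := mem_adj.1 (hr hv)
      have h1 : ∀ y ∈ Ideal.span (W : Set (MvPolynomial (Fin (n + 1)) ℂ)), y * u ∈ adj I l := by
        intro y hy
        induction hy using Submodule.span_induction with
        | mem y hy => exact hu y hy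
        | zero => simp
        | add y z _ _ hy hz => rw [add_mul]; exact Ideal.add_mem _ hy hz
        | smul r y _ hy => rw [smul_eq_mul, mul_assoc]; exact Ideal.mul_mem_left _ _ hy
      have := Ideal.add_mem _ (h1 _ hs) (Ideal.mul_mem_left _ (s * u) (self_mem_adj I l))
      convert this using 1; ring
    obtain ⟨g, hgW, hg, -⟩ := avoid (adj I l) (adj I l) W hs hs
    have hgI : g ∉ I := by
      intro h
      apply Dp_ne_top hd
      rw [Ideal.eq_top_iff_one]
      apply hg
      rw [mul_one]
      exact le_adj _ _ h
    obtain ⟨p1, p2⟩ := perm hhom hl le_rfl (hW g hgW) hnz hg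
    refine ⟨Gs ⊔ Submodule.span ℂ {g}, ?_, ?_, ?_, ?_⟩
    · rw [sup_le_iff]
      exact ⟨hG, by rw [Submodule.span_singleton_le_iff_mem]; exact hgW⟩
    · infer_instance
    · rw [finrank_sup_one Gs (fun h => hgI (Ideal.subset_span h)), hrank]
    · rw [span_adj, ← hIdef]
      refine ⟨hhom.adj (hW g hgW), p2, ?_, ?_⟩
      · rw [adj_comm]
        exact Dp_cut (hhom.adj hl) hd (hW g hgW) he hg
      · rw [HS_cut hhom (hW g hgW) p1, hH]; ring

end seq

section dual
variable {N : ℕ}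

theorem homComp_zero_lin {l v : MvPolynomial (Fin N) ℂ} (hl : l.IsHomogeneous 1) :
    homogeneousComponent 0 ((l - 1) * v) = - homogeneousComponent 0 v := by
  rw [sub_mul, one_mul, map_sub, homComp_mul_lt hl v 0 (by omega), zero_sub]

theorem homComp_succ_lin {l v : MvPolynomial (Fin N) ℂ} (hl : l.IsHomogeneous 1) (j : ℕ) :
    homogeneousComponent (j + 1) ((l - 1) * v) =
      l * homogeneousComponent j v - homogeneousComponent (j + 1) v := by
  rw [sub_mul, one_mul, map_sub, homComp_mul hl v j]

theorem dehom {I : Ideal (MvPolynomial (Fin N) ℂ)} (hI : Hom I) {l : MvPolynomial (Fin N) ℂ}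
    (hl : l.IsHomogeneous 1) (hnl : Nz I l) {u : MvPolynomial (Fin N) ℂ} {k : ℕ}
    (hu : u.IsHomogeneous k) (h : u ∈ adj I (l - 1)) : u ∈ I := by
  obtain ⟨v, hv⟩ := mem_adj.1 h
  have hc := hI _ hv
  have hlow : ∀ j, j < k → homogeneousComponent j v ∈ I := by
    intro j
    induction j with
    | zero =>
      intro hj
      have := hc 0
      rw [map_sub, homComp_zero_lin hl, homogeneousComponent_of_mem (n := k) hu,
        if_neg (by omega)] at this
      simpa using this
    | succ j ih =>
      intro hj
      have := hc (j + 1)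
      rw [map_sub, homComp_succ_lin hl, homogeneousComponent_of_mem (n := k) hu,
        if_neg (by omega)] at this
      have := I.add_mem this (I.mul_mem_left l (ih (by omega)))
      convert this using 1; ring
  have hk : homogeneousComponent k v + u ∈ I := by
    have := hc k
    rw [map_sub, homComp_self hu] at this
    cases k with
    | zero => rw [homComp_zero_lin hl] at this; convert this using 1; ring
    | succ k =>
      rw [homComp_succ_lin hl] at this
      have := I.add_mem this (I.mul_mem_left l (hlow k (by omega)))
      convert this using 1; ring
  have hhigh : ∀ m, homogeneousComponent (k + m) v + l ^ m * u ∈ I := by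
    intro m
    induction m with
    | zero => simpa using hk
    | succ m ih =>
      have := hc (k + m + 1)
      rw [map_sub, homComp_succ_lin hl, homogeneousComponent_of_mem (n := k) hu,
        if_neg (by omega)] at this
      have := I.add_mem this (I.mul_mem_left l ih)
      convert this using 1; rw [add_assoc]; ring
  have h1 := hhigh (v.totalDegree + 1)
  rw [homogeneousComponent_eq_zero _ _ (by omega), zero_add] at h1
  have : ∀ m, l ^ m * u ∈ I → u ∈ I := by
    intro m
    induction m with
    | zero => intro h; simpa using h
    | succ m ih =>
      intro h
      apply ih
      apply hnl
      convert h using 1; ring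
  exact this _ h1

theorem hf_eq_zero {I : Ideal (MvPolynomial (Fin N) ℂ)} {k : ℕ} (h : hf I k = 0)
    {u : MvPolynomial (Fin N) ℂ} (hu : u.IsHomogeneous k) : u ∈ I := by
  have : (homogeneousSubmodule (Fin N) ℂ k).map
    (Submodule.mkQ (Submodule.restrictScalars ℂ I)) = ⊥ := Submodule.finrank_eq_zero.1 h
  rw [← mkQ_eq_zero, ← Submodule.mem_bot ℂ, ← this]
  exact ⟨u, hu, rfl⟩

theorem exists_of_hf_ne_zero {I : Ideal (MvPolynomial (Fin N) ℂ)} {k : ℕ} (h : hf I k ≠ 0) :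
    ∃ u : MvPolynomial (Fin N) ℂ, u.IsHomogeneous k ∧ u ∉ I := by
  by_contra hcon
  push Not at hcon
  apply h
  unfold hf
  have : (homogeneousSubmodule (Fin N) ℂ k).map
    (Submodule.mkQ (Submodule.restrictScalars ℂ I)) = ⊥ := by
    rw [eq_bot_iff]
    rintro _ ⟨u, hu, rfl⟩
    rw [Submodule.mem_bot, mkQ_eq_zero]
    exact hcon u hu
  rw [this, finrank_bot]

/-- Gorenstein property of an Artinian graded quotient with one-dimensional socle. -/
theorem gor {D : Ideal (MvPolynomial (Fin N) ℂ)} (hD : Hom D) (hs : SocOne D) {s : ℕ}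
    (h1 : hf D s = 1) (h2 : hf D (s + 1) = 0) (m : ℕ) :
    ∀ j, j + m = s → ∀ U : MvPolynomial (Fin N) ℂ, U.IsHomogeneous j → U ∉ D →
      ∃ W : MvPolynomial (Fin N) ℂ, W.IsHomogeneous m ∧ U * W ∉ D := by
  induction m with
  | zero => intro j _ U _ hU'; exact ⟨1, isHomogeneous_one _ _, by simpa using hU'⟩
  | succ m ih =>
    intro j hj U hU hU'
    have : ∃ i, X i * U ∉ D := by
      by_contra hcon
      push Not at hcon
      obtain ⟨w, hw, -, hw2⟩ := hs
      obtain ⟨Y, hY, hY'⟩ := exists_of_hf_ne_zero (I := D) (k := s) (by omega)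
      obtain ⟨c, hc⟩ := hw2 U hcon
      obtain ⟨c', hc'⟩ := hw2 Y (fun i => hf_eq_zero h2 (by
        rw [add_comm]; exact (isHomogeneous_X _ i).mul hY))
      have hc0 : c' ≠ 0 := by
        rintro rfl
        apply hY'
        simpa using hc'
      have h3 : U - C (c / c') * Y ∈ D := by
        have := D.sub_mem hc (D.mul_mem_left (C (c / c')) hc')
        convert this using 1
        have : (C c : MvPolynomial (Fin N) ℂ) = C (c / c') * C c' := by
          rw [← C_mul, div_mul_cancel₀ c hc0]
        rw [this]; ring
      apply hU'
      have h4 := hD _ h3 j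
      rw [map_sub, homComp_self hU, homogeneousComponent_of_mem (n := s) (hY.C_mul _),
        if_neg (by omega), sub_zero] at h4
      exact h4
    obtain ⟨i, hi⟩ := this
    obtain ⟨W, hW, hW'⟩ := ih (j + 1) (by omega) (X i * U) (by
      rw [add_comm]; exact (isHomogeneous_X _ i).mul hU) hi
    refine ⟨X i * W, by rw [add_comm]; exact (isHomogeneous_X _ i).mul hW, ?_⟩
    convert hW' using 2; ring

/-- The main duality. -/
theorem duality {I : Ideal (MvPolynomial (Fin N) ℂ)} (hI : Hom I) {l : MvPolynomial (Fin N) ℂ}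
    (hl : l.IsHomogeneous 1) (hnl : Nz I l) (hs : SocOne (adj I l)) {s : ℕ}
    (hs1 : hf (adj I l) (s + 1) = 1) (hs2 : ∀ j, s + 1 < j → hf (adj I l) j = 0)
    {h : MvPolynomial (Fin N) ℂ} {e : ℕ} (hh : h.IsHomogeneous e) {p : ℕ}
    (E : MvPolynomial (Fin N) ℂ →ₐ[ℂ] (Fin p → ℂ)) (hE : Function.Surjective E)
    (hker : ∀ u, E u = 0 ↔ u ∈ adj (adj I (l - 1)) h) (k : ℕ) (hk : k ≤ s) :
    hf I (s - k) + Module.finrank ℂ ((homogeneousSubmodule (Fin N) ℂ k).map E.toLinearMap) =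
      hfm I h (s - k) + p := by
  set b := adj I (l - 1) with hb
  let B := MvPolynomial (Fin N) ℂ ⧸ b
  let q : MvPolynomial (Fin N) ℂ →ₐ[ℂ] B := Ideal.Quotient.mkₐ ℂ b
  have hq0 : ∀ u, q u = 0 ↔ u ∈ b := fun u => Ideal.Quotient.eq_zero_iff_mem
  have hqs : Function.Surjective q := Ideal.Quotient.mk_surjective
  have hql : q l = 1 := by
    have : q (l - 1) = 0 := (hq0 _).2 (self_mem_adj _ _)
    rw [map_sub, map_one, sub_eq_zero] at this
    exact this
  let V : ℕ → Submodule ℂ B := fun k => (homogeneousSubmodule (Fin N) ℂ k).map q.toLinearMap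
  have hVmem : ∀ k u, u ∈ V k ↔ ∃ U : MvPolynomial (Fin N) ℂ, U.IsHomogeneous k ∧ q U = u :=
    fun k u => Iff.rfl
  have hVfin : ∀ k, FiniteDimensional ℂ (V k) := fun k => inferInstance
  have hVrank : ∀ k, Module.finrank ℂ (V k) = hf I k := by
    intro k
    apply rank_eq
    intro u hu
    rw [mkQ_eq_zero, AlgHom.toLinearMap_apply, hq0]
    exact ⟨dehom hI hl hnl hu, fun h => le_adj _ _ h⟩
  have hVsucc : ∀ k, V k ≤ V (k + 1) := by
    rintro k _ ⟨u, hu, rfl⟩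
    refine (hVmem _ _).2 ⟨l * u, by rw [add_comm]; exact hl.mul hu, ?_⟩
    rw [map_mul, hql, one_mul]; rfl
  have hVmono : Monotone V := monotone_nat_of_le_succ hVsucc
  have hVmul : ∀ i j u v, u ∈ V i → v ∈ V j → u * v ∈ V (i + j) := by
    rintro i j _ _ ⟨u, hu, rfl⟩ ⟨v, hv, rfl⟩
    exact (hVmem _ _).2 ⟨u * v, IsHomogeneous.mul hu hv, map_mul _ _ _⟩
  have hdrop : ∀ j (U : MvPolynomial (Fin N) ℂ), U.IsHomogeneous (j + 1) → U ∈ adj I l →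
      q U ∈ V j := by
    intro j U hU hUD
    obtain ⟨t, ht, ht'⟩ := mem_adj_hom hI hl hU hUD
    refine (hVmem _ _).2 ⟨t, ht, ?_⟩
    have : q (U - l * t) = 0 := (hq0 _).2 (le_adj _ _ ht')
    rw [map_sub, map_mul, hql, one_mul, sub_eq_zero] at this
    exact this.symm
  have hVtop' : ∀ m, V (s + 1 + m) ≤ V (s + 1) := by
    intro m
    induction m with
    | zero => exact le_rfl
    | succ m ih =>
      rintro _ ⟨u, hu, rfl⟩
      exact ih (hdrop _ u hu (hf_eq_zero (hs2 _ (by omega)) hu))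
  have hVtop : V (s + 1) = ⊤ := by
    rw [eq_top_iff]
    rintro u -
    obtain ⟨U, rfl⟩ := hqs u
    rw [← sum_homogeneousComponent U, map_sum]
    refine Submodule.sum_mem _ fun i _ => ?_
    apply hVtop' i
    apply hVmono (show i ≤ s + 1 + i by omega)
    exact (hVmem _ _).2 ⟨_, homogeneousComponent_isHomogeneous _ _, rfl⟩
  have hBfin : FiniteDimensional ℂ B := by
    have := hVfin (s + 1)
    rw [hVtop] at this
    exact Module.Finite.equiv (Submodule.topEquiv (R := ℂ) (M := B))
  have hBrank : Module.finrank ℂ B = Module.finrank ℂ (V s) + 1 := by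
    rw [← finrank_top, ← hVtop, hVrank, hVrank, hf_cut hI hl, hfm_nz hnl, hs1, add_comm]
  -- the functional
  obtain ⟨τ, hτ0, hτ⟩ := Submodule.exists_le_ker_of_lt_top (V s) (by
    rw [lt_top_iff_ne_top]
    intro h
    rw [h, finrank_top] at hBrank
    omega)
  have hτker : LinearMap.ker τ = V s := by
    symm
    apply Submodule.eq_of_le_of_finrank_le hτ
    have h1 := LinearMap.finrank_range_add_finrank_ker τ
    have h2 : Module.finrank ℂ (LinearMap.range τ) ≠ 0 := by
      intro h
      exact hτ0 (LinearMap.range_eq_bot.1 (Submodule.finrank_eq_zero.1 h))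
    omega
  have hτ' : ∀ u, τ u = 0 ↔ u ∈ V s := fun u => by rw [← hτker, LinearMap.mem_ker]
  -- key nondegeneracy
  have key : ∀ u : B, u ≠ 0 → ∃ j ≤ s + 1, u ∈ V j ∧ ∃ w ∈ V (s + 1 - j), τ (u * w) ≠ 0 := by
    intro u hu
    classical
    have hex : ∃ j, u ∈ V j := ⟨s + 1, by rw [hVtop]; trivial⟩
    have hj := Nat.find_spec hex
    have hjmin := fun m => Nat.find_min hex (m := m)
    have hjle : Nat.find hex ≤ s + 1 := Nat.find_min' hex (by rw [hVtop]; trivial)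
    generalize Nat.find hex = j at hj hjmin hjle
    refine ⟨j, hjle, hj, ?_⟩
    obtain ⟨U, hU, rfl⟩ := hj
    have hUD : U ∉ adj I l := by
      intro hUD
      cases j with
      | zero =>
        apply hu
        exact (hq0 _).2 (le_adj _ _ (mem_adj_hom_lt hI hl (by omega) hU hUD))
      | succ j => exact hjmin j (by omega) (hdrop j U hU hUD)
    obtain ⟨W, hW, hUW⟩ := gor (hI.adj hl) hs hs1 (hs2 _ (by omega)) (s + 1 - j) j (by omega)
      U hU hUD
    refine ⟨q W, (hVmem _ _).2 ⟨W, hW, rfl⟩, ?_⟩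
    intro h0
    rw [hτ', AlgHom.toLinearMap_apply, ← map_mul] at h0
    obtain ⟨Y, hY, hY'⟩ := h0
    apply hUW
    rw [mem_adj]
    refine ⟨Y, ?_⟩
    apply dehom hI hl hnl (k := s + 1)
    · apply IsHomogeneous.sub
      · have := IsHomogeneous.mul hU hW
        rwa [show j + (s + 1 - j) = s + 1 by omega] at this
      · rw [add_comm]; exact hl.mul hY
    · rw [← hb, ← hq0, map_sub, map_mul q l, hql, one_mul, sub_eq_zero]
      exact hY'.symm
  -- the form
  let β : LinearMap.BilinForm ℂ B := (LinearMap.mul ℂ B).compr₂ τ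
  have hβ : ∀ u v, β u v = τ (u * v) := fun u v => rfl
  have hβker : LinearMap.ker β = ⊥ := by
    rw [eq_bot_iff]
    intro u hu
    rw [Submodule.mem_bot]
    by_contra hu0
    obtain ⟨j, _, _, w, _, hw⟩ := key u hu0
    apply hw
    rw [← hβ]
    rw [LinearMap.mem_ker] at hu
    rw [hu]; rfl
  let Eb : B →ₐ[ℂ] (Fin p → ℂ) := Ideal.Quotient.liftₐ b E
    (fun u hu => (hker u).2 (le_adj _ _ hu))
  have hEb : ∀ u, Eb (q u) = E u := fun u => rfl
  let K : Submodule ℂ B := LinearMap.ker Eb.toLinearMap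
  have hK : ∀ u, u ∈ K ↔ ∃ v, u = q h * v := by
    intro u
    obtain ⟨U, rfl⟩ := hqs u
    change Eb (q U) = 0 ↔ _
    rw [hEb, hker, mem_adj]
    constructor
    · rintro ⟨t, ht⟩
      refine ⟨q t, ?_⟩
      rw [← sub_eq_zero, ← map_mul, ← map_sub, hq0]; exact ht
    · rintro ⟨v, hv⟩
      obtain ⟨t, rfl⟩ := hqs v
      refine ⟨t, ?_⟩
      rw [← sub_eq_zero, ← map_mul, ← map_sub, hq0] at hv; exact hv
  have horth : β.orthogonal (V k ⊔ K) =
      V (s - k) ⊓ LinearMap.ker (LinearMap.mulLeft ℂ (q h)) := by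
    ext u
    rw [LinearMap.BilinForm.mem_orthogonal_iff, Submodule.mem_inf, LinearMap.mem_ker,
      LinearMap.mulLeft_apply]
    constructor
    · intro hu
      constructor
      · by_cases hu0 : u = 0
        · rw [hu0]; exact Submodule.zero_mem _
        obtain ⟨j, hj, huj, w, hw, hτw⟩ := key u hu0
        have : k < s + 1 - j := by
          by_contra hcon
          apply hτw
          rw [mul_comm, ← hβ]
          exact hu w (Submodule.mem_sup_left (hVmono (by omega) hw))
        exact hVmono (by omega) huj
      · by_contra hu0
        obtain ⟨j, hj, huj, w, hw, hτw⟩ := key _ hu0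
        apply hτw
        rw [show q h * u * w = (q h * w) * u by ring, ← hβ]
        exact hu _ (Submodule.mem_sup_right ((hK _).2 ⟨w, rfl⟩))
    · rintro ⟨hu1, hu2⟩ x hx
      obtain ⟨y, hy, z, hz, rfl⟩ := Submodule.mem_sup.1 hx
      obtain ⟨v, rfl⟩ := (hK z).1 hz
      rw [hβ, add_mul, show q h * v * u = v * (q h * u) by ring, hu2, mul_zero, add_zero, hτ']
      have := hVmul _ _ _ _ hy hu1
      rwa [show k + (s - k) = s by omega] at this
  have r1 := LinearMap.BilinForm.finrank_add_finrank_orthogonal' (B := β) (V k ⊔ K)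
  rw [hβker, inf_bot_eq, finrank_bot, add_zero, horth] at r1
  have r2 := rank_null (LinearMap.mulLeft ℂ (q h)) (V (s - k))
  rw [hVrank] at r2
  have r3 : Module.finrank ℂ ((V (s - k)).map (LinearMap.mulLeft ℂ (q h))) = hfm I h (s - k) := by
    change Module.finrank ℂ ((Submodule.map q.toLinearMap _).map (LinearMap.mulLeft ℂ (q h))) = _
    rw [← Submodule.map_comp]
    apply rank_eq
    intro u hu
    rw [LinearMap.comp_apply, LinearMap.comp_apply, mkQ_eq_zero, AlgHom.toLinearMap_apply,
      LinearMap.mulLeft_apply, LinearMap.mulLeft_apply, ← map_mul, hq0]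
    exact ⟨dehom hI hl hnl (hh.mul hu), fun h => le_adj _ _ h⟩
  have r4 := rank_null Eb.toLinearMap (V k ⊔ K)
  have r5 : (V k ⊔ K) ⊓ LinearMap.ker Eb.toLinearMap = K := inf_eq_right.2 le_sup_right
  have r6 : (V k ⊔ K).map Eb.toLinearMap =
      (homogeneousSubmodule (Fin N) ℂ k).map E.toLinearMap := by
    have hK0 : K.map Eb.toLinearMap = ⊥ := by
      rw [eq_bot_iff]; rintro _ ⟨u, hu, rfl⟩; exact hu
    rw [Submodule.map_sup, hK0, sup_bot_eq]
    change (Submodule.map q.toLinearMap _).map _ = _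
    rw [← Submodule.map_comp]
    rfl
  rw [r5, r6] at r4
  have r7 := LinearMap.finrank_range_add_finrank_ker Eb.toLinearMap
  have r8 : LinearMap.range Eb.toLinearMap = ⊤ := by
    rw [LinearMap.range_eq_top]
    intro y
    obtain ⟨U, hU⟩ := hE y
    exact ⟨q U, hU⟩
  rw [r8, finrank_top, Module.finrank_fin_fun] at r7
  change p + Module.finrank ℂ K = _ at r7
  rw [r3] at r2
  omega

end dual

section geom
variable {N : ℕ}

/-- the maximal ideal of a point -/
noncomputable def mx (b : Fin N → ℂ) : Ideal (MvPolynomial (Fin N) ℂ) := RingHom.ker (eval b)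

theorem mem_mx {b : Fin N → ℂ} {u : MvPolynomial (Fin N) ℂ} : u ∈ mx b ↔ eval b u = 0 :=
  RingHom.mem_ker

theorem mx_max (b : Fin N → ℂ) : (mx b).IsMaximal :=
  RingHom.ker_isMaximal_of_surjective _ fun c => ⟨C c, eval_C c⟩

theorem mx_coprime {b c : Fin N → ℂ} (h : b ≠ c) : IsCoprime (mx b) (mx c) := by
  have := mx_max b
  have := mx_max c
  apply Ideal.isCoprime_of_isMaximal
  intro heq
  apply h
  funext i
  have : X i - C (b i) ∈ mx b := by rw [mem_mx]; simp
  rw [heq, mem_mx] at this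
  simp only [map_sub, eval_X, eval_C] at this
  exact (sub_eq_zero.1 this).symm

/-- Nullstellensatz -/
theorem nss {A P : Ideal (MvPolynomial (Fin N) ℂ)}
    (h : ∀ x : Fin N → ℂ, (∀ u ∈ A, eval x u = 0) → ∀ u ∈ P, eval x u = 0) :
    ∃ r, P ^ r ≤ A := by
  apply Ideal.exists_pow_le_of_le_radical_of_fg
  · rw [← vanishingIdeal_zeroLocus_eq_radical (K := ℂ)]
    intro u hu
    rw [mem_vanishingIdeal_iff]
    intro x hx
    rw [mem_zeroLocus_iff] at hx
    rw [aeval_eq_eval]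
    exact h x (fun v hv => by have := hx v hv; rwa [aeval_eq_eval] at this) u hu
  · exact IsNoetherian.noetherian P

theorem idem_aux {R B : Type*} [CommRing R] [CommRing B] (φ : R →+* B) {p : ℕ}
    (ms : Fin p → Ideal R) (A : Ideal R) (hA : A.map φ = ⊥)
    (hreg : ∀ t, ms t ≤ A ⊔ ms t ^ 2) {r : ℕ} (hr : (∏ t, ms t) ^ r ≤ A) :
    (∏ t, ms t).map φ = ⊥ := by
  have hid : ∀ t, (ms t).map φ * (ms t).map φ = (ms t).map φ := by
    intro t
    apply le_antisymm Ideal.mul_le_left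
    have := Ideal.map_mono (f := φ) (hreg t)
    rw [Ideal.map_sup, hA, bot_sup_eq, pow_two, Ideal.map_mul] at this
    exact this
  have hPm : (∏ t, ms t).map φ = ∏ t, (ms t).map φ := map_prod (Ideal.mapHom φ) _ _
  have hPi : IsIdempotentElem ((∏ t, ms t).map φ) := by
    unfold IsIdempotentElem
    rw [hPm, ← Finset.prod_mul_distrib]
    exact Finset.prod_congr rfl fun t _ => hid t
  rw [← hPi.pow_succ_eq r, eq_bot_iff, ← Ideal.map_pow, ← hA]
  exact Ideal.map_mono ((Ideal.pow_le_pow_right (Nat.le_succ r)).trans hr)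

theorem radical_of_nodes {p : ℕ} (A : Ideal (MvPolynomial (Fin N) ℂ)) (b : Fin p → Fin N → ℂ)
    (hb : Function.Injective b)
    (hz : ∀ x : Fin N → ℂ, (∀ u ∈ A, eval x u = 0) → ∃ t, x = b t)
    (hreg : ∀ t, mx (b t) ≤ A ⊔ mx (b t) ^ 2) (u : MvPolynomial (Fin N) ℂ)
    (hu : ∀ t, eval (b t) u = 0) : u ∈ A := by
  let P : Ideal (MvPolynomial (Fin N) ℂ) := ∏ t, mx (b t)
  have hP : u ∈ P := by
    change u ∈ ∏ t, mx (b t)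
    rw [Ideal.prod_eq_iInf_of_pairwise_isCoprime]
    · simp only [Ideal.mem_iInf]
      intro t _
      exact mem_mx.2 (hu t)
    · intro s _ t _ hst
      exact mx_coprime (fun h => hst (hb h))
  obtain ⟨r, hr⟩ := nss (A := A) (P := P) (by
    intro x hx v hv
    obtain ⟨t, rfl⟩ := hz x hx
    exact mem_mx.1 (Ideal.prod_le_inf.trans (Finset.inf_le (Finset.mem_univ t)) hv))
  let φ := Ideal.Quotient.mk A
  have h0 : P.map φ = ⊥ := idem_aux φ (fun t => mx (b t)) A (Ideal.map_quotient_self A) hreg hr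
  have h1 : φ u ∈ P.map φ := Ideal.mem_map_of_mem φ hP
  rw [h0, Ideal.mem_bot] at h1
  exact Ideal.Quotient.eq_zero_iff_mem.1 h1

theorem eval_surj {p : ℕ} (b : Fin p → Fin N → ℂ) (hb : Function.Injective b) (y : Fin p → ℂ) :
    ∃ u : MvPolynomial (Fin N) ℂ, ∀ t, eval (b t) u = y t := by
  obtain ⟨u, hu⟩ := Ideal.exists_forall_sub_mem_ideal (I := fun t => mx (b t))
    (fun s t hst => mx_coprime (fun h => hst (hb h))) (fun t => C (y t))
  refine ⟨u, fun t => ?_⟩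
  have := mem_mx.1 (hu t)
  rw [map_sub, eval_C, sub_eq_zero] at this
  exact this

/-- linear form centered at `b` -/
noncomputable def lin (b : Fin N → ℂ) : (Fin N → ℂ) →ₗ[ℂ] MvPolynomial (Fin N) ℂ :=
  Fintype.linearCombination ℂ (fun i => X i - C (b i))

theorem lin_apply (b c : Fin N → ℂ) : lin b c = ∑ i, C (c i) * (X i - C (b i)) := by
  simp only [lin, Fintype.linearCombination_apply, smul_eq_C_mul]

theorem lin_mem (b c : Fin N → ℂ) : lin b c ∈ mx b := by
  rw [mem_mx, lin_apply, map_sum]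
  apply Finset.sum_eq_zero
  intro i _
  simp

theorem taylor (b : Fin N → ℂ) (f : MvPolynomial (Fin N) ℂ) :
    f - C (eval b f) - lin b (fun i => eval b (pderiv i f)) ∈ mx b ^ 2 := by
  induction f using MvPolynomial.induction_on with
  | C c =>
    have : (fun i => eval b (pderiv i (C c : MvPolynomial (Fin N) ℂ))) = 0 := by
      funext i; simp
    rw [this]; simp
  | add f g hf hg =>
    have : (fun i => eval b (pderiv i (f + g))) =
      (fun i => eval b (pderiv i f)) + (fun i => eval b (pderiv i g)) := by
      funext i; simp
    rw [this, map_add, map_add, map_add]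
    convert Ideal.add_mem _ hf hg using 1
    ring
  | mul_X f j hf =>
    have : (fun i => eval b (pderiv i (f * X j))) =
      b j • (fun i => eval b (pderiv i f)) + eval b f • (Pi.single j 1) := by
      funext i
      simp only [Derivation.leibniz, pderiv_X, smul_eq_mul, map_add, map_mul, eval_X,
        Pi.add_apply, Pi.smul_apply, Pi.single_apply, apply_ite (eval b), map_one, map_zero]
      by_cases h : i = j
      · subst h; simp; ring
      · simp [h, Ne.symm h]
    have h2 : lin b (Pi.single j 1) = X j - C (b j) := by
      simp [lin]
    rw [this, map_add, map_smul, map_smul, h2, smul_eq_C_mul, smul_eq_C_mul, map_mul, eval_X,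
      C_mul]
    have h3 : (f - C (eval b f)) * (X j - C (b j)) ∈ mx b ^ 2 := by
      rw [pow_two]
      apply Ideal.mul_mem_mul <;> simp [mem_mx]
    convert Ideal.add_mem _ (Ideal.mul_mem_left _ (C (b j)) hf) h3 using 1
    ring

theorem reg_of_hess {n : ℕ} (A : Ideal (MvPolynomial (Fin (n + 1)) ℂ)) (b : Fin (n + 1) → ℂ)
    (f : Fin (n + 1) → MvPolynomial (Fin (n + 1)) ℂ) (hf : ∀ j, f j ∈ A)
    (hf0 : ∀ j, eval b (f j) = 0)
    (hrank : Matrix.rank (Matrix.of fun i j : Fin (n + 1) => eval b (pderiv i (f j))) = n)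
    (hker : ∀ j, ∑ i, eval b (pderiv i (f j)) * b i = 0)
    (c : Fin (n + 1) → ℂ) (hc : ∑ i, c i * b i ≠ 0) (hcA : lin b c ∈ A) :
    mx b ≤ A ⊔ mx b ^ 2 := by
  let Q : Submodule ℂ (Fin (n + 1) → ℂ) :=
    (Submodule.restrictScalars ℂ (A ⊔ mx b ^ 2)).comap (lin b)
  have hQ : ∀ v, v ∈ Q ↔ lin b v ∈ A ⊔ mx b ^ 2 := fun v => Iff.rfl
  let M := Matrix.of fun i j : Fin (n + 1) => eval b (pderiv i (f j))
  let R : Submodule ℂ (Fin (n + 1) → ℂ) := Submodule.span ℂ (Set.range M.col)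
  have hR : Module.finrank ℂ R = n := by
    exact (Matrix.rank_eq_finrank_span_cols M).symm.trans hrank
  have hRQ : R ≤ Q := by
    rw [Submodule.span_le]
    rintro _ ⟨j, rfl⟩
    rw [SetLike.mem_coe, hQ]
    have h := taylor b (f j)
    rw [hf0, C_0, sub_zero] at h
    have := Ideal.sub_mem _ (show f j ∈ A ⊔ mx b ^ 2 from Ideal.mem_sup_left (hf j))
      (Ideal.mem_sup_right h)
    rw [sub_sub_cancel] at this
    exact this
  have hcR : c ∉ R := by
    intro hcR
    apply hc
    have : R ≤ LinearMap.ker (Fintype.linearCombination ℂ b) := by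
      rw [Submodule.span_le]
      rintro _ ⟨j, rfl⟩
      rw [SetLike.mem_coe, LinearMap.mem_ker, Fintype.linearCombination_apply]
      exact hker j
    exact this hcR
  have hcQ : c ∈ Q := (hQ c).2 (Ideal.mem_sup_left hcA)
  have hT : Q = ⊤ := by
    apply Submodule.eq_top_of_finrank_eq
    apply le_antisymm (Submodule.finrank_le _)
    have h1 := finrank_sup_one R hcR
    rw [hR] at h1
    rw [Module.finrank_fin_fun]
    refine h1.symm.le.trans ?_
    apply Submodule.finrank_mono
    apply sup_le hRQ
    rw [Submodule.span_singleton_le_iff_mem]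
    exact hcQ
  intro u hu
  have h := taylor b u
  rw [mem_mx.1 hu, C_0, sub_zero] at h
  have h2 : (fun i => eval b (pderiv i u)) ∈ Q := by rw [hT]; trivial
  have := Ideal.add_mem (A ⊔ mx b ^ 2) (Ideal.mem_sup_right h) ((hQ _).1 h2)
  rwa [sub_add_cancel] at this

theorem eval_smul_hom {f : MvPolynomial (Fin N) ℂ} {k : ℕ} (hf : f.IsHomogeneous k) (c : ℂ)
    (x : Fin N → ℂ) : eval (c • x) f = c ^ k * eval x f := by
  rw [eval_eq, eval_eq, Finset.mul_sum]
  apply Finset.sum_congr rfl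
  intro m hm
  have hk : m.degree = k := by
    have := hf (mem_support_iff.1 hm)
    rw [← this, Finsupp.degree_eq_weight_one]; rfl
  have : ∏ i ∈ m.support, (c • x) i ^ m i = c ^ k * ∏ i ∈ m.support, x i ^ m i := by
    simp only [Pi.smul_apply, smul_eq_mul, mul_pow, Finset.prod_mul_distrib,
      Finset.prod_pow_eq_pow_sum]
    rw [← hk]; rfl
  rw [this]; ring

/-- a linear form not vanishing at finitely many nonzero points -/
theorem exists_lin {n p : ℕ} (a : Fin p → Fin (n + 1) → ℂ) (ha : ∀ t, a t ≠ 0) :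
    ∃ c : Fin (n + 1) → ℂ, c ≠ 0 ∧ ∀ t, ∑ i, c i * a t i ≠ 0 := by
  let L : Fin p → MvPolynomial (Fin (n + 1)) ℂ := fun t => ∑ i, C (a t i) * X i
  have hL : ∀ t x, eval x (L t) = ∑ i, x i * a t i := by
    intro t x
    simp only [L, map_sum, map_mul, eval_C, eval_X]
    exact Finset.sum_congr rfl fun i _ => mul_comm _ _
  have hL0 : ∀ t, L t ≠ 0 := by
    intro t h
    apply ha t
    funext i
    have := hL t (Pi.single i 1)
    rw [h] at this
    simpa [Pi.single_apply] using this.symm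
  have hprod : X 0 * ∏ t, L t ≠ 0 :=
    mul_ne_zero (X_ne_zero 0) (Finset.prod_ne_zero_iff.2 fun t _ => hL0 t)
  by_contra hcon
  push Not at hcon
  apply hprod
  apply MvPolynomial.funext
  intro x
  rw [map_mul, map_prod, map_zero, eval_X]
  by_cases hx : x = 0
  · rw [hx]; simp
  · obtain ⟨t, ht⟩ := hcon x hx
    rw [Finset.prod_eq_zero (Finset.mem_univ t) (by rw [hL]; exact ht), mul_zero]

end geom

section final

theorem hilb_part {n e : ℕ} {I : Ideal (MvPolynomial (Fin (n + 1)) ℂ)}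
    (hI : Hom I) {l : MvPolynomial (Fin (n + 1)) ℂ} (hl : l.IsHomogeneous 1) (hnl : Nz I l)
    (hHS : HS I = (1 - PowerSeries.X ^ e) ^ n * HS (⊥ : Ideal (MvPolynomial (Fin (n + 1)) ℂ))) :
    (∀ j, hf (adj I l) j = (G e ^ n).coeff j) ∧
      ∀ j, hf I (j + e) = hf I j + (G e ^ (n + 1)).coeff (j + e) := by
  have h0 : (1 - PowerSeries.X : PowerSeries ℤ) ≠ 0 := by
    intro h
    have := congrArg (PowerSeries.coeff 0) h
    simp at this
  have hb := HS_bot (N := n + 1)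
  have h1 : (1 - PowerSeries.X) * HS I = GS e ^ n := by
    rw [hHS, ← GS_mul, mul_pow]
    calc _ = GS e ^ n * ((1 - PowerSeries.X) ^ (n + 1) *
          HS (⊥ : Ideal (MvPolynomial (Fin (n + 1)) ℂ))) := by ring
      _ = _ := by rw [hb, mul_one]
  have h2 : (1 - PowerSeries.X ^ e) * HS I = GS e ^ (n + 1) := by
    rw [← GS_mul, pow_succ, ← h1]; ring
  constructor
  · intro j
    have := HS_cut hI hl hnl
    rw [pow_one, h1] at this
    have := congrArg (PowerSeries.coeff j) this
    rw [GS_coeff] at this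
    simp only [HS, PowerSeries.coeff_mk] at this
    exact_mod_cast this
  · intro j
    have := congrArg (PowerSeries.coeff (j + e)) h2
    rw [GS_coeff, sub_mul, one_mul, map_sub, PowerSeries.coeff_X_pow_mul] at this
    simp only [HS, PowerSeries.coeff_mk] at this
    rw [sub_eq_iff_eq_add'] at this
    exact_mod_cast this

theorem core (n e : ℕ) (hn : 1 ≤ n) (he : 2 ≤ e) (f : Fin (n + 1) → MvPolynomial (Fin (n + 1)) ℂ)
    (hf' : ∀ j, (f j).IsHomogeneous e) (l : MvPolynomial (Fin (n + 1)) ℂ)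
    (hl : l.IsHomogeneous 1) (hl0 : l ≠ 0) (r : ℕ)
    (hr : (varI (n + 1) (n + 1)) ^ r ≤ adj (Ideal.span (Set.range f)) l) {p : ℕ}
    (E : MvPolynomial (Fin (n + 1)) ℂ →ₐ[ℂ] (Fin p → ℂ)) (hE : Function.Surjective E)
    (hker : ∀ u, E u = 0 ↔ u ∈ adj (Ideal.span (Set.range f)) (l - 1)) (k : ℕ)
    (hk : k ≤ n * (e - 1) - 1) :
    hf (Ideal.span (Set.range f)) ((n + 1) * (e - 1) - k) +
      Module.finrank ℂ ((homogeneousSubmodule (Fin (n + 1)) ℂ k).map E.toLinearMap) =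
      (G e ^ (n + 1)).coeff k + p := by
  let W : Submodule ℂ (MvPolynomial (Fin (n + 1)) ℂ) := Submodule.span ℂ (Set.range f)
  have hWJ : Ideal.span (W : Set (MvPolynomial (Fin (n + 1)) ℂ)) = Ideal.span (Set.range f) :=
    Submodule.span_span_of_tower _ _ _
  have hW : ∀ w ∈ W, w.IsHomogeneous e := by
    have : W ≤ homogeneousSubmodule (Fin (n + 1)) ℂ e := by
      rw [Submodule.span_le]
      rintro _ ⟨j, rfl⟩
      exact hf' j
    exact this
  have hWr : Module.finrank ℂ W ≤ n + 1 := by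
    have := finrank_range_le_card (R := ℂ) f
    rwa [Fintype.card_fin] at this
  have hWfin : FiniteDimensional ℂ W := FiniteDimensional.span_of_finite ℂ (Set.finite_range f)
  rw [← hWJ] at hr hker ⊢
  obtain ⟨Gs, hGW, hGfin, hGr, hI, hnl, hD, hHS⟩ :=
    exists_seq n e (by omega) W hW l hl hl0 r hr n le_rfl
  rw [Nat.sub_self] at hD
  obtain ⟨hA, hB⟩ := hilb_part hI hl hnl hHS
  obtain ⟨h, hhe, hWh⟩ : ∃ h : MvPolynomial (Fin (n + 1)) ℂ, h.IsHomogeneous e ∧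
      W = Gs ⊔ Submodule.span ℂ {h} := by
    by_cases hWG : W ≤ Gs
    · refine ⟨0, isHomogeneous_zero _ _ _, ?_⟩
      rw [Submodule.span_zero_singleton, sup_bot_eq]
      exact le_antisymm hWG hGW
    · obtain ⟨h, hhW, hhG⟩ := Set.not_subset.1 hWG
      refine ⟨h, hW h hhW, ?_⟩
      symm
      apply Submodule.eq_of_le_of_finrank_le
      · apply sup_le hGW
        rw [Submodule.span_singleton_le_iff_mem]
        exact hhW
      · rw [finrank_sup_one Gs hhG, hGr]
        exact hWr
  have hJ : Ideal.span (W : Set (MvPolynomial (Fin (n + 1)) ℂ)) =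
      adj (Ideal.span (Gs : Set (MvPolynomial (Fin (n + 1)) ℂ))) h := by
    rw [hWh, span_adj]
  rw [hJ] at hker ⊢
  have hpos : 1 ≤ n * (e - 1) := Nat.mul_pos hn (by omega)
  have hs : n * (e - 1) - 1 + 1 = n * (e - 1) := by omega
  have d1 := duality hI hl hnl hD (s := n * (e - 1) - 1)
    (by rw [hA, hs]; exact G_pow_top e n (by omega))
    (fun j hj => by rw [hA]; exact G_pow_gt e n j (by omega) (by omega)) hhe E hE
    (fun u => by rw [adj_comm]; exact hker u) k hk
  have d2 := hf_cut hI hhe (n * (e - 1) - 1 - k)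
  have d3 := hB (n * (e - 1) - 1 - k)
  have d4 : n * (e - 1) - 1 - k + e = (n + 1) * (e - 1) - k := by
    rw [add_mul, one_mul]; omega
  have d5 := G_pow_symm e (n + 1) k (by omega) (by rw [add_mul, one_mul]; omega)
  rw [d4] at d2 d3
  omega

theorem span_range {N p : ℕ} (a : Fin p → Fin N → ℂ)
    (θ : MvPolynomial (Fin N) ℂ →ₗ[ℂ] (Fin p → ℂ)) (hθ : ∀ u t, θ u t = eval (a t) u) (k : ℕ) :
    Submodule.span ℂ (Set.range (fun H : homogeneousSubmodule (Fin N) ℂ k =>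
        fun t : Fin p => eval (a t) (H : MvPolynomial (Fin N) ℂ))) =
      (homogeneousSubmodule (Fin N) ℂ k).map θ := by
  apply le_antisymm
  · rw [Submodule.span_le]
    rintro _ ⟨H, rfl⟩
    exact ⟨H.1, H.2, funext fun t => hθ H.1 t⟩
  · intro y hy
    obtain ⟨H, hH, hy⟩ := Submodule.mem_map.1 hy
    apply Submodule.subset_span
    refine Set.mem_range.2 ⟨⟨H, hH⟩, ?_⟩
    funext t
    rw [← hy, hθ]

set_option maxHeartbeats 1000000 in
theorem main (n d : ℕ) (hn : 2 ≤ n) (hd : 3 ≤ d)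
    (F : MvPolynomial (Fin (n + 1)) ℂ) (hF : F.IsHomogeneous d)
    (p : ℕ) (a : Fin p → (Fin (n + 1) → ℂ))
    (ha0 : ∀ t, a t ≠ 0)
    (hsing : {x : Fin (n + 1) → ℂ | x ≠ 0 ∧ ∀ i, eval x (pderiv i F) = 0} =
      {x | ∃ (t : Fin p) (c : ℂ), c ≠ 0 ∧ x = c • a t})
    (hdist : ∀ s t : Fin p, s ≠ t → ∀ c : ℂ, a s ≠ c • a t)
    (hnode : ∀ t : Fin p,
      Matrix.rank (Matrix.of fun i j : Fin (n + 1) =>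
        eval (a t) (pderiv i (pderiv j F))) = n) (k : ℕ) (hk : k ≤ n * d - 2 * n - 1) :
    hf (Ideal.span (Set.range fun i => pderiv i F)) ((n + 1) * (d - 2) - k) =
      (G (d - 1) ^ (n + 1)).coeff k +
          (p - Module.finrank ℂ (Submodule.span ℂ (Set.range
            (fun H : homogeneousSubmodule (Fin (n + 1)) ℂ k =>
              fun t : Fin p => eval (a t) (H : MvPolynomial (Fin (n + 1)) ℂ))))) := by
  obtain ⟨c, hc0, hc⟩ := exists_lin a ha0
  let l : MvPolynomial (Fin (n + 1)) ℂ := ∑ i, C (c i) * X i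
  have hlev : ∀ x, eval x l = ∑ i, c i * x i := by
    intro x
    simp only [l, map_sum, map_mul, eval_C, eval_X]
  have hl : l.IsHomogeneous 1 :=
    IsHomogeneous.sum _ _ _ fun i _ => (isHomogeneous_X _ i).C_mul _
  have hl0 : l ≠ 0 := by
    intro h
    apply hc0
    funext i
    have := hlev (Pi.single i 1)
    rw [h] at this
    simpa [Pi.single_apply] using this.symm
  have hsing' : ∀ x : Fin (n + 1) → ℂ, (x ≠ 0 ∧ ∀ i, eval x (pderiv i F) = 0) ↔
      ∃ (t : Fin p) (c : ℂ), c ≠ 0 ∧ x = c • a t := fun x => Set.ext_iff.1 hsing x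
  let f : Fin (n + 1) → MvPolynomial (Fin (n + 1)) ℂ := fun i => pderiv i F
  have hfe : ∀ j, (f j).IsHomogeneous (d - 1) := fun j => hF.pderiv
  have hfJ : ∀ j, f j ∈ Ideal.span (Set.range f) := fun j => Ideal.subset_span ⟨j, rfl⟩
  -- normalized points
  let m : Fin p → ℂ := fun t => (∑ i, c i * a t i)⁻¹
  have hm : ∀ t, m t ≠ 0 := fun t => inv_ne_zero (hc t)
  let b : Fin p → Fin (n + 1) → ℂ := fun t => m t • a t
  have hlb : ∀ t, eval (b t) l = 1 := by
    intro t
    rw [eval_smul_hom hl, pow_one, hlev]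
    exact inv_mul_cancel₀ (hc t)
  have hbinj : Function.Injective b := by
    intro s t hst
    by_contra hne
    apply hdist s t hne ((m s)⁻¹ * m t)
    have : m s • a s = m t • a t := hst
    rw [mul_smul, ← this, smul_smul, inv_mul_cancel₀ (hm s), one_smul]
  have hfb : ∀ t j, eval (b t) (f j) = 0 := fun t =>
    ((hsing' (b t)).2 ⟨t, m t, hm t, rfl⟩).2
  -- first use of the Nullstellensatz
  obtain ⟨r, hr⟩ := nss (A := adj (Ideal.span (Set.range f)) l) (P := varI (n + 1) (n + 1)) (by
    intro x hx u hu
    have hx0 : x = 0 := by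
      by_contra hx0
      obtain ⟨t, c', hc', rfl⟩ := (hsing' x).1 ⟨hx0, fun i => hx _ (le_adj _ _ (hfJ i))⟩
      have := hx l (self_mem_adj _ _)
      rw [eval_smul_hom hl, pow_one, hlev] at this
      exact mul_ne_zero hc' (hc t) this
    rw [hx0]
    rw [mem_varI_top, constantCoeff_eq] at hu
    rw [← constantCoeff_eq] at hu
    rw [show eval (0 : Fin (n + 1) → ℂ) u = constantCoeff u by
      rw [← eval_zero]]
    exact hu)
  -- evaluation map
  let E : MvPolynomial (Fin (n + 1)) ℂ →ₐ[ℂ] (Fin p → ℂ) :=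
    AlgHom.pi fun t => aeval (b t)
  have hEt : ∀ u t, E u t = eval (b t) u := by
    intro u t
    change aeval (b t) u = _
    rw [aeval_eq_eval]
  have hEs : Function.Surjective E := by
    intro y
    obtain ⟨u, hu⟩ := eval_surj b hbinj y
    exact ⟨u, funext fun t => by rw [hEt, hu]⟩
  have hreg : ∀ t, mx (b t) ≤ adj (Ideal.span (Set.range f)) (l - 1) ⊔ mx (b t) ^ 2 := by
    intro t
    apply reg_of_hess _ (b t) f (fun j => le_adj _ _ (hfJ j)) (hfb t) ?_ ?_ c ?_ ?_
    · refine Eq.trans ?_ (hnode t)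
      have : (Matrix.of fun i j : Fin (n + 1) => eval (b t) (pderiv i (f j))) =
        (m t ^ (d - 1 - 1)) • (Matrix.of fun i j : Fin (n + 1) =>
          eval (a t) (pderiv i (pderiv j F))) := by
        ext i j
        rw [Matrix.smul_apply, Matrix.of_apply, Matrix.of_apply, smul_eq_mul]
        exact eval_smul_hom (hfe j).pderiv _ _
      rw [this]
      exact Matrix.rank_smul_of_mem_nonZeroDivisors _
        (mem_nonZeroDivisors_of_ne_zero (pow_ne_zero _ (hm t)))
    · intro j
      have := congrArg (eval (b t)) (hfe j).sum_X_mul_pderiv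
      rw [map_sum, map_nsmul, hfb, smul_zero] at this
      rw [← this]
      exact Finset.sum_congr rfl fun i _ => by rw [map_mul, eval_X, mul_comm]
    · rw [← hlev, hlb]; exact one_ne_zero
    · have : lin (b t) c = l - 1 := by
        rw [lin_apply]
        simp only [mul_sub, Finset.sum_sub_distrib]
        congr 1
        have h1 := hlb t
        rw [hlev] at h1
        rw [← C_1, ← h1, map_sum]
        exact Finset.sum_congr rfl fun i _ => by rw [C_mul]
      rw [this]
      exact self_mem_adj _ _
  have hEk : ∀ u, E u = 0 ↔ u ∈ adj (Ideal.span (Set.range f)) (l - 1) := by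
    intro u
    constructor
    · intro hu
      apply radical_of_nodes _ b hbinj ?_ hreg
      · intro t; rw [← hEt, hu]; rfl
      · intro x hx
        have hx1 : eval x l = 1 := by
          have := hx _ (self_mem_adj _ _)
          rwa [map_sub, map_one, sub_eq_zero] at this
        have hx0 : x ≠ 0 := by
          rintro rfl
          rw [hlev] at hx1
          simp at hx1
        obtain ⟨t, c', hc', rfl⟩ := (hsing' x).1 ⟨hx0, fun i => hx _ (le_adj _ _ (hfJ i))⟩
        refine ⟨t, ?_⟩
        rw [eval_smul_hom hl, pow_one, hlev] at hx1
        change c' • a t = m t • a t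
        rw [eq_inv_of_mul_eq_one_left hx1]
    · intro hu
      funext t
      rw [hEt]
      have hle : adj (Ideal.span (Set.range f)) (l - 1) ≤ mx (b t) := by
        unfold adj
        apply sup_le
        · rw [Ideal.span_le]
          rintro _ ⟨j, rfl⟩
          exact mem_mx.2 (hfb t j)
        · rw [Ideal.span_le, Set.singleton_subset_iff]
          apply mem_mx.2
          rw [map_sub, map_one, hlb, sub_self]
      exact mem_mx.1 (hle hu)
  have hnd : n * d - 2 * n - 1 = n * (d - 1 - 1) - 1 := by
    rw [Nat.sub_sub d 1 1, Nat.mul_sub, mul_comm 2 n]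
  have hcore := core n (d - 1) (by omega) (by omega) f hfe l hl hl0 r hr E hEs hEk k
    (by rw [← hnd]; exact hk)
  -- comparison of ranks
  let θ : MvPolynomial (Fin (n + 1)) ℂ →ₗ[ℂ] (Fin p → ℂ) :=
    LinearMap.pi fun t => (aeval (a t)).toLinearMap
  have hθ : ∀ u t, θ u t = eval (a t) u := by
    intro u t
    change aeval (a t) u = _
    rw [aeval_eq_eval]
  have hspan : Submodule.span ℂ (Set.range
      (fun H : homogeneousSubmodule (Fin (n + 1)) ℂ k =>
        fun t : Fin p => eval (a t) (H : MvPolynomial (Fin (n + 1)) ℂ))) =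
      (homogeneousSubmodule (Fin (n + 1)) ℂ k).map θ :=
    span_range a θ hθ k
  have hrk : Module.finrank ℂ ((homogeneousSubmodule (Fin (n + 1)) ℂ k).map θ) =
      Module.finrank ℂ ((homogeneousSubmodule (Fin (n + 1)) ℂ k).map E.toLinearMap) := by
    apply rank_eq
    intro u hu
    rw [funext_iff, funext_iff]
    apply forall_congr'
    intro t
    rw [hθ, AlgHom.toLinearMap_apply, hEt, eval_smul_hom hu]
    simp [hm t]
  have hle := Submodule.finrank_le ((homogeneousSubmodule (Fin (n + 1)) ℂ k).map θ)
  rw [Module.finrank_fin_fun] at hle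
  rw [hspan]
  rw [show d - 1 - 1 = d - 2 by omega, ← hrk] at hcore
  change hf (Ideal.span (Set.range f)) ((n + 1) * (d - 2) - k) = _
  omega

end final

end NodalDefect

/-- Defect formula for nodal hypersurfaces: if `{F = 0} ⊂ ℙⁿ` (with `F` of degree `d`) has
exactly `p` singular points `[a₁],…,[a_p]`, all nodes (the Hessian of `F` at each `a_t`
has rank `n`), then for `0 ≤ k ≤ nd - 2n - 1`,
`dim M(F)_{T-k} = m_k + dim coker θ_k`, where `T = (n+1)(d-2)`, `m_k` is the Hilbert
coefficient of a smooth degree-`d` form, and `θ_k : S_k → ℂ^p` is evaluation at the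
singular points (so `dim coker θ_k = p - rank θ_k`). -/
theorem defect_formula_nodal (n d : ℕ) (hn : 2 ≤ n) (hd : 3 ≤ d)
    (F : MvPolynomial (Fin (n + 1)) ℂ) (hF : F.IsHomogeneous d)
    (p : ℕ) (a : Fin p → (Fin (n + 1) → ℂ))
    (ha0 : ∀ t, a t ≠ 0)
    (hsing : {x : Fin (n + 1) → ℂ | x ≠ 0 ∧ ∀ i, eval x (pderiv i F) = 0} =
      {x | ∃ (t : Fin p) (c : ℂ), c ≠ 0 ∧ x = c • a t})
    (hdist : ∀ s t : Fin p, s ≠ t → ∀ c : ℂ, a s ≠ c • a t)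
    (hnode : ∀ t : Fin p,
      Matrix.rank (Matrix.of fun i j : Fin (n + 1) =>
        eval (a t) (pderiv i (pderiv j F))) = n) :
    ∀ k ≤ n * d - 2 * n - 1,
      Module.finrank ℂ (milnorPiece F ((n + 1) * (d - 2) - k)) =
        hilbCoeff (n + 1) d k +
          (p - Module.finrank ℂ (Submodule.span ℂ (Set.range
            (fun H : homogeneousSubmodule (Fin (n + 1)) ℂ k =>
              fun t : Fin p => eval (a t) (H : MvPolynomial (Fin (n + 1)) ℂ))))) := by
  intro k hk
  exact NodalDefect.main n d hn hd F hF p a ha0 hsing hdist hnode k hk
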